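/- Let (R,m) be a Noetherian local ring of positive dimension d and let Q be a parameter ideal of R. The following are equivalent: (i) R is Cohen-Macaulay; (ii) R is unmixed and e_1(Q) = 0; (iii) R is unmixed and e_1(Q) ≥ 0. -/

import Mathlib

open Finset IsLocalRing

/-- The length of an `R`-module `M`: the Krull dimension of its lattice of submodules,
i.e. the supremum of the lengths of chains of submodules of `M`. -/
noncomputable def moduleLength (R M : Type*) [CommRing R] [AddCommGroup M] [Module R M] :
    WithBot ℕ∞ :=
  Order.krullDim (Submodule R M)

/-- A local Noetherian ring is Cohen-Macaulay if its depth equals its Krull dimension,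
equivalently, if it admits a regular sequence in the maximal ideal whose length is the
Krull dimension. -/
def IsCohenMacaulayLocalRing (R : Type*) [CommRing R] [IsLocalRing R] : Prop :=
  ∃ rs : List R, (∀ x ∈ rs, x ∈ maximalIdeal R) ∧
    RingTheory.Sequence.IsRegular R rs ∧ (rs.length : WithBot ℕ∞) = ringKrullDim R

/-- `e 0, …, e d` are the Hilbert coefficients of an ideal `I` in a ring of dimension `d`:
for all large `n`, `λ(R ⧸ I^(n+1)) = ∑_{i=0}^{d} (-1)^i (e i) C(n+d-i, d-i)`. -/
def HasHilbertCoeffs {R : Type*} [CommRing R] (I : Ideal R) (d : ℕ) (e : ℕ → ℤ) : Prop :=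
  ∃ N : ℕ, ∀ n ≥ N, ∃ l : ℕ,
    moduleLength R (R ⧸ I ^ (n + 1)) = (l : WithBot ℕ∞) ∧
    (l : ℤ) = ∑ i ∈ Finset.range (d + 1), (-1 : ℤ) ^ i * e i * ((n + d - i).choose (d - i))

/-- A parameter ideal of a `d`-dimensional Noetherian local ring: an ideal contained in the
maximal ideal, generated by `d` elements, with `λ(R/Q) < ∞`. -/
def IsParameterIdeal {R : Type*} [CommRing R] [IsLocalRing R] (d : ℕ) (Q : Ideal R) : Prop :=
  Q ≤ maximalIdeal R ∧ (∃ x : Fin d → R, Q = Ideal.span (Set.range x)) ∧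
    ∃ l : ℕ, moduleLength R (R ⧸ Q) = (l : WithBot ℕ∞)

/-- A Noetherian local ring `R` is unmixed if `dim(R̂/p) = dim R̂` for every associated
prime `p` of the `m`-adic completion `R̂` of `R`. -/
def IsUnmixedLocalRing (R : Type*) [CommRing R] [IsLocalRing R] : Prop :=
  ∀ p ∈ associatedPrimes (AdicCompletion (maximalIdeal R) R)
      (AdicCompletion (maximalIdeal R) R),
    ringKrullDim (AdicCompletion (maximalIdeal R) R ⧸ p) =
      ringKrullDim (AdicCompletion (maximalIdeal R) R)

open scoped Pointwise

section Length

variable {R M : Type*} [CommRing R] [AddCommGroup M] [Module R M]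

theorem length_quotient_anti {N N' : Submodule R M} (h : N ≤ N') :
    Module.length R (M ⧸ N') ≤ Module.length R (M ⧸ N) := by
  rw [Module.length_quotient, Module.length_quotient]
  exact Order.coheight_anti h

theorem eq_of_le_of_length_quotient_le {N N' : Submodule R M} (h : N ≤ N')
    (hl : Module.length R (M ⧸ N) ≤ Module.length R (M ⧸ N'))
    (ht : Module.length R (M ⧸ N') ≠ ⊤) : N = N' := by
  rw [Module.length_quotient, Module.length_quotient] at *
  by_contra hne
  exact absurd (Order.coheight_strictAnti (lt_of_le_of_ne h hne) (lt_top_iff_ne_top.2 ht))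
    (not_lt.2 hl)

theorem length_quotient_eq_comap_add {M' : Type*} [AddCommGroup M'] [Module R M']
    (f : M' →ₗ[R] M) (N : Submodule R M) :
    Module.length R (M ⧸ N) = Module.length R (M' ⧸ N.comap f) +
      Module.length R (M ⧸ (N ⊔ LinearMap.range f)) := by
  refine Module.length_eq_add_of_exact (N := M' ⧸ N.comap f) (P := M ⧸ (N ⊔ LinearMap.range f))
    (Submodule.mapQ _ _ f le_rfl) (Submodule.mapQ _ _ LinearMap.id le_sup_left) ?_ ?_ ?_
  · rw [← LinearMap.ker_eq_bot, Submodule.ker_mapQ]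
    simp
  · rw [← LinearMap.range_eq_top, Submodule.range_mapQ]
    simp
  · rw [LinearMap.exact_iff, Submodule.ker_mapQ, Submodule.range_mapQ]
    simp [Submodule.map_sup]

theorem length_quotient_eq_add {N N' : Submodule R M} (h : N ≤ N') :
    Module.length R (M ⧸ N) = Module.length R (N' ⧸ N.comap N'.subtype) +
      Module.length R (M ⧸ N') := by
  have := length_quotient_eq_comap_add N'.subtype N
  rwa [Submodule.range_subtype, sup_eq_right.2 h] at this

end Length

section PowerLength

variable {R M : Type*} [CommRing R] [AddCommGroup M] [Module R M]

theorem range_lsmul_eq (x : R) : LinearMap.range (LinearMap.lsmul R M x) = x • ⊤ := by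
  ext z
  simp [Submodule.mem_smul_pointwise_iff_exists]

theorem length_colon (x : R) (N : Submodule R M) :
    Module.length R (M ⧸ N) = Module.length R (M ⧸ N.comap (LinearMap.lsmul R M x)) +
      Module.length R (M ⧸ (N ⊔ x • ⊤)) := by
  rw [← range_lsmul_eq]
  exact length_quotient_eq_comap_add _ _

theorem sup_pow_le (I J : Ideal R) (n : ℕ) : (I ⊔ J) ^ n ≤ I ⊔ J ^ n := by
  induction n with
  | zero => simp
  | succ n ih =>
    have h1 : (I ⊔ J ^ n) * I ≤ I := Submodule.smul_le_right
    have h2 : I * J ≤ I := Ideal.mul_le_left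
    calc (I ⊔ J) ^ (n + 1) = (I ⊔ J) ^ n * (I ⊔ J) := pow_succ _ _
      _ ≤ (I ⊔ J ^ n) * (I ⊔ J) := Ideal.mul_mono_left ih
      _ = (I ⊔ J ^ n) * I ⊔ (I * J ⊔ J ^ (n + 1)) := by
        rw [Ideal.mul_sup, Ideal.sup_mul I (J ^ n) J, ← pow_succ]
      _ ≤ I ⊔ J ^ (n + 1) := sup_le (h1.trans le_sup_left) (sup_le_sup_right h2 _)

theorem ofList_cons_pow_sup (x : R) (xs : List R) (n : ℕ) :
    (Ideal.ofList (x :: xs)) ^ n • (⊤ : Submodule R M) ⊔ x • ⊤ =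
      (Ideal.ofList xs) ^ n • ⊤ ⊔ x • ⊤ := by
  rw [← Submodule.ideal_span_singleton_smul, Ideal.ofList_cons]
  apply le_antisymm
  · refine sup_le ((Submodule.smul_mono_left (sup_pow_le _ _ n)).trans ?_) le_sup_right
    rw [Submodule.sup_smul, sup_comm]
  · exact sup_le_sup_right (Submodule.smul_mono_left (Ideal.pow_right_mono le_sup_right n)) _

theorem length_quotSMulTop (x : R) (I : Ideal R) :
    Module.length R (QuotSMulTop x M ⧸ (I • ⊤ : Submodule R (QuotSMulTop x M))) =
      Module.length R (M ⧸ (I • ⊤ ⊔ x • ⊤ : Submodule R M)) := by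
  have h : (I • ⊤ : Submodule R (QuotSMulTop x M)) =
      (I • ⊤ : Submodule R M).map (x • ⊤ : Submodule R M).mkQ := by
    rw [Submodule.map_smul'', Submodule.map_top, Submodule.range_mkQ]
  rw [h, sup_comm]
  exact (Submodule.quotientQuotientEquivQuotientSup _ _).length_eq

theorem pow_smul_le_comap (x : R) (xs : List R) (n : ℕ) :
    (Ideal.ofList (x :: xs)) ^ n • (⊤ : Submodule R M) ≤
      ((Ideal.ofList (x :: xs)) ^ (n + 1) • ⊤ : Submodule R M).comap (LinearMap.lsmul R M x) := by
  intro z hz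
  rw [Submodule.mem_comap, pow_succ', Submodule.mul_smul]
  refine Submodule.smul_mem_smul ?_ hz
  rw [Ideal.ofList_cons]
  exact Ideal.mem_sup_left (Ideal.mem_span_singleton_self x)

theorem length_ofList_cons (x : R) (xs : List R) (n : ℕ) :
    Module.length R (M ⧸ ((Ideal.ofList (x :: xs)) ^ n • ⊤ : Submodule R M)) =
      Module.length R (M ⧸ ((Ideal.ofList (x :: xs)) ^ n • ⊤ : Submodule R M).comap
        (LinearMap.lsmul R M x)) +
      Module.length R (QuotSMulTop x M ⧸
        ((Ideal.ofList xs) ^ n • ⊤ : Submodule R (QuotSMulTop x M))) := by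
  rw [length_colon x, length_quotSMulTop, ofList_cons_pow_sup]

theorem length_quotSMulTop_one (x : R) (xs : List R) :
    Module.length R (QuotSMulTop x M ⧸ (Ideal.ofList xs • ⊤ : Submodule R (QuotSMulTop x M))) =
      Module.length R (M ⧸ (Ideal.ofList (x :: xs) • ⊤ : Submodule R M)) := by
  rw [length_quotSMulTop, Ideal.ofList_cons, Submodule.sup_smul,
    Submodule.ideal_span_singleton_smul, sup_comm]

theorem choose_pascal (n d : ℕ) :
    (n + 1 + (d + 1)).choose (d + 1) = (n + (d + 1)).choose (d + 1) + (n + 1 + d).choose d := by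
  rw [show n + 1 + (d + 1) = (n + (d + 1)) + 1 by ring, Nat.choose_succ_succ, add_comm,
    show n + (d + 1) = n + 1 + d by ring]

end PowerLength

theorem length_quotient_pow_le {R : Type*} [CommRing R] (xs : List R) :
    ∀ (M : Type _) [AddCommGroup M] [Module R M] (n : ℕ),
      Module.length R (M ⧸ ((Ideal.ofList xs) ^ (n + 1) • ⊤ : Submodule R M)) ≤
        Module.length R (M ⧸ (Ideal.ofList xs • ⊤ : Submodule R M)) *
          ((n + xs.length).choose xs.length : ℕ) := by
  induction xs with
  | nil => intro M _ _ n; rw [Ideal.ofList_nil, ← Ideal.zero_eq_bot, zero_pow n.succ_ne_zero]; simp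
  | cons x xs ih =>
    intro M _ _ n
    induction n with
    | zero => rw [zero_add, pow_one]; simp
    | succ n ihn =>
      rw [length_ofList_cons, List.length_cons, choose_pascal, Nat.cast_add, mul_add]
      refine add_le_add ((length_quotient_anti (pow_smul_le_comap x xs (n + 1))).trans ihn) ?_
      rw [← length_quotSMulTop_one]
      exact ih _ (n + 1)

theorem isWeaklyRegular_of_length {R : Type*} [CommRing R] [IsNoetherianRing R] [IsLocalRing R]
    (xs : List R) : ∀ (M : Type _) [AddCommGroup M] [Module R M] [Module.Finite R M]
      (_ : ∀ x ∈ xs, x ∈ maximalIdeal R)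
      (_ : Module.length R (M ⧸ (Ideal.ofList xs • ⊤ : Submodule R M)) ≠ ⊤)
      (_ : ∀ n : ℕ, Module.length R (M ⧸ (Ideal.ofList xs • ⊤ : Submodule R M)) *
          ((n + xs.length).choose xs.length : ℕ) ≤
        Module.length R (M ⧸ ((Ideal.ofList xs) ^ (n + 1) • ⊤ : Submodule R M))),
      RingTheory.Sequence.IsWeaklyRegular M xs := by
  induction xs with
  | nil => intro M _ _ _ _ _ _; exact RingTheory.Sequence.IsWeaklyRegular.nil R M
  | cons x xs ih =>
    intro M _ _ _ hm ht h
    set ℓ := Module.length R (M ⧸ (Ideal.ofList (x :: xs) • ⊤ : Submodule R M)) with hℓ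
    have hfin : ∀ k d : ℕ, ℓ * ((k + d).choose d : ℕ) ≠ ⊤ := fun k d =>
      WithTop.mul_ne_top ht (ENat.natCast_ne_top _)
    rw [RingTheory.Sequence.isWeaklyRegular_cons_iff]
    have key := fun n : ℕ => length_ofList_cons (M := M) x xs (n + 1)
    have h1 := fun n : ℕ => length_quotient_anti (pow_smul_le_comap (M := M) x xs n)
    have h2 := fun n : ℕ => length_quotient_pow_le (x :: xs) M n
    have h3 := fun n : ℕ => length_quotient_pow_le xs (QuotSMulTop x M) n
    rw [length_quotSMulTop_one, ← hℓ] at h3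
    simp only [← hℓ] at h2
    constructor
    · have hcolon : ∀ n, ((Ideal.ofList (x :: xs)) ^ (n + 1) • (⊤ : Submodule R M)) =
          ((Ideal.ofList (x :: xs)) ^ (n + 1 + 1) • ⊤ : Submodule R M).comap
            (LinearMap.lsmul R M x) := by
        intro n
        refine eq_of_le_of_length_quotient_le (pow_smul_le_comap x xs (n + 1)) ?_ ?_
        · refine (h2 n).trans ?_
          have e1 := h (n + 1)
          rw [key (n + 1), List.length_cons, choose_pascal, Nat.cast_add, mul_add] at e1
          have e2 := e1.trans (add_le_add_right (h3 (n + 1)) _)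
          exact (ENat.add_le_add_iff_right (hfin _ _)).1 e2
        · exact ne_top_of_le_ne_top (hfin _ _) ((h1 (n + 1)).trans (h2 n))
      rw [isSMulRegular_iff_right_eq_zero_of_smul]
      intro z hz
      have hI : Ideal.ofList (x :: xs) ≠ ⊤ := by
        refine ne_top_of_le_ne_top (maximalIdeal.isMaximal R).ne_top ?_
        exact Ideal.span_le.2 hm
      have hz' : z ∈ (⨅ i : ℕ, (Ideal.ofList (x :: xs)) ^ i • ⊤ : Submodule R M) := by
        rw [Submodule.mem_iInf]
        intro i
        have : z ∈ ((Ideal.ofList (x :: xs)) ^ (i + 1) • (⊤ : Submodule R M)) := by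
          rw [hcolon, Submodule.mem_comap]
          simp [hz]
        exact Submodule.smul_mono_left (Ideal.pow_le_pow_right (Nat.le_succ i)) this
      rwa [Ideal.iInf_pow_smul_eq_bot_of_isLocalRing _ hI, Submodule.mem_bot] at hz'
    · apply ih
      · exact fun y hy => hm y (List.mem_cons_of_mem _ hy)
      · rw [length_quotSMulTop_one]; exact ht
      · intro n
        rw [length_quotSMulTop_one, ← hℓ]
        cases n with
        | zero =>
          have := length_quotSMulTop_one (M := M) x xs
          rw [zero_add, pow_one, this]
          simp [← hℓ]
        | succ n =>
          have e1 := h (n + 1)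
          rw [key (n + 1), List.length_cons, choose_pascal, Nat.cast_add, mul_add] at e1
          have e2 := e1.trans (add_le_add_left ((h1 (n + 1)).trans (h2 n)) _)
          exact (ENat.add_le_add_iff_left (hfin _ _)).1 e2

section RegularPowers

variable {R : Type*} [CommRing R]

theorem sup_pow_succ_le (I J : Ideal R) (n : ℕ) :
    (I ⊔ J) ^ (n + 1) ≤ J ^ (n + 1) ⊔ I * (I ⊔ J) ^ n := by
  induction n with
  | zero => simp
  | succ n ih =>
    have h1 : J ^ (n + 1) * I ≤ I * (I ⊔ J) ^ (n + 1) := by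
      rw [mul_comm]
      exact Ideal.mul_mono_right (Ideal.pow_right_mono le_sup_right _)
    calc (I ⊔ J) ^ (n + 1 + 1) = (I ⊔ J) ^ (n + 1) * (I ⊔ J) := pow_succ _ _
      _ ≤ (J ^ (n + 1) ⊔ I * (I ⊔ J) ^ n) * (I ⊔ J) := Ideal.mul_mono_left ih
      _ = (J ^ (n + 1) * I ⊔ J ^ (n + 1 + 1)) ⊔ I * (I ⊔ J) ^ (n + 1) := by
        rw [Ideal.sup_mul, Ideal.mul_sup, ← pow_succ, mul_assoc, ← pow_succ]
      _ ≤ _ := sup_le (sup_le (h1.trans le_sup_right) le_sup_left) le_sup_right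

theorem mem_pow_of_smul_mem_pow {M : Type*} [AddCommGroup M] [Module R M] (x : R) (xs : List R)
    (h : ∀ (j : ℕ) (z : M), x • z ∈ (Ideal.ofList xs ^ j • ⊤ : Submodule R M) →
      z ∈ (Ideal.ofList xs ^ j • ⊤ : Submodule R M)) (n : ℕ) (w : M)
    (hw : x • w ∈ (Ideal.ofList (x :: xs) ^ (n + 1) • ⊤ : Submodule R M)) :
    w ∈ (Ideal.ofList (x :: xs) ^ n • ⊤ : Submodule R M) := by
  have hle : (Ideal.ofList (x :: xs) ^ (n + 1) • ⊤ : Submodule R M) ≤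
      Ideal.ofList xs ^ (n + 1) • ⊤ ⊔ x • (Ideal.ofList (x :: xs) ^ n • ⊤) := by
    rw [← Submodule.ideal_span_singleton_smul, ← Submodule.mul_smul, ← Submodule.sup_smul]
    refine Submodule.smul_mono_left ?_
    rw [Ideal.ofList_cons]
    exact sup_pow_succ_le _ _ n
  obtain ⟨q, hq, v, hv, hqv⟩ := Submodule.mem_sup.1 (hle hw)
  obtain ⟨u, hu, rfl⟩ := (Submodule.mem_smul_pointwise_iff_exists _ _ _).1 hv
  have h1 : w - u ∈ (Ideal.ofList xs ^ (n + 1) • ⊤ : Submodule R M) := by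
    apply h
    rwa [smul_sub, ← hqv, add_sub_cancel_right]
  have h2 : (Ideal.ofList xs ^ (n + 1) • ⊤ : Submodule R M) ≤ Ideal.ofList (x :: xs) ^ n • ⊤ := by
    refine Submodule.smul_mono_left ((Ideal.pow_le_pow_right n.le_succ).trans
      (Ideal.pow_right_mono ?_ _))
    rw [Ideal.ofList_cons]
    exact le_sup_right
  simpa using add_mem (h2 h1) hu

theorem mem_of_smul_mem_pow_of_isWeaklyRegular [IsNoetherianRing R] [IsLocalRing R] (xs : List R) :
    ∀ (M : Type _) [AddCommGroup M] [Module R M] [Module.Finite R M] (y : R)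
      (_ : ∀ x ∈ y :: xs, x ∈ maximalIdeal R)
      (_ : RingTheory.Sequence.IsWeaklyRegular M (y :: xs)) (j : ℕ) (z : M),
      y • z ∈ (Ideal.ofList xs ^ j • ⊤ : Submodule R M) →
      z ∈ (Ideal.ofList xs ^ j • ⊤ : Submodule R M) := by
  induction xs with
  | nil =>
    intro M _ _ _ y _ hr j z hz
    cases j with
    | zero => simp
    | succ j =>
      rw [Ideal.ofList_nil, ← Ideal.zero_eq_bot, zero_pow j.succ_ne_zero] at hz ⊢
      rw [RingTheory.Sequence.isWeaklyRegular_cons_iff] at hr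
      simp only [Ideal.zero_eq_bot, Submodule.bot_smul, Submodule.mem_bot] at hz ⊢
      exact hr.1.right_eq_zero_of_smul hz
  | cons x xs ih =>
    intro M _ _ _ y hm hr
    have hr1 : RingTheory.Sequence.IsWeaklyRegular M (x :: y :: xs) :=
      IsLocalRing.isWeaklyRegular_of_perm_of_subset_maximalIdeal hr (List.Perm.swap _ _ _) hm
    have hr2 : RingTheory.Sequence.IsWeaklyRegular M (x :: xs) := by
      have : RingTheory.Sequence.IsWeaklyRegular M ((x :: xs) ++ [y]) :=
        IsLocalRing.isWeaklyRegular_of_perm_of_subset_maximalIdeal hr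
          (List.perm_append_singleton _ _).symm hm
      exact ((RingTheory.Sequence.isWeaklyRegular_append_iff _ _ _).1 this).1
    have hmx : ∀ a ∈ x :: xs, a ∈ maximalIdeal R := fun a ha => hm a (List.mem_cons_of_mem _ ha)
    have hmy : ∀ a ∈ y :: xs, a ∈ maximalIdeal R := fun a ha => hm a (by
      rw [List.mem_cons] at ha ⊢
      exact ha.imp_right (List.mem_cons_of_mem _))
    rw [RingTheory.Sequence.isWeaklyRegular_cons_iff] at hr1
    have hK := ih M x hmx hr2
    have hKbar := ih (QuotSMulTop x M) y hmy hr1.2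
    have hbar : ∀ j, (Ideal.ofList xs ^ j • ⊤ : Submodule R (QuotSMulTop x M)) =
        (Ideal.ofList xs ^ j • ⊤ : Submodule R M).map (x • ⊤ : Submodule R M).mkQ := by
      intro j
      rw [Submodule.map_smul'', Submodule.map_top, Submodule.range_mkQ]
    intro j
    induction j with
    | zero => intro z _; simp
    | succ j ihj =>
      intro z hz
      have h1 : y • z ∈ (Ideal.ofList xs ^ (j + 1) • ⊤ ⊔ x • ⊤ : Submodule R M) := by
        rw [← ofList_cons_pow_sup]
        exact Submodule.mem_sup_left hz
      have h2 : y • (Submodule.Quotient.mk z : QuotSMulTop x M) ∈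
          (Ideal.ofList xs ^ (j + 1) • ⊤ : Submodule R (QuotSMulTop x M)) := by
        rw [hbar]
        obtain ⟨q, hq, v, hv, hqv⟩ := Submodule.mem_sup.1 h1
        refine ⟨q, hq, ?_⟩
        rw [← Submodule.Quotient.mk_smul, ← hqv, Submodule.mkQ_apply, Submodule.Quotient.mk_add,
          (Submodule.Quotient.mk_eq_zero _).2 hv, add_zero]
      have h3 := hKbar _ _ h2
      rw [hbar] at h3
      obtain ⟨q, hq, hqz⟩ := h3
      rw [Submodule.mkQ_apply, eq_comm, Submodule.Quotient.eq] at hqz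
      obtain ⟨w, -, hw⟩ := (Submodule.mem_smul_pointwise_iff_exists _ _ _).1 hqz
      have hq' : q ∈ (Ideal.ofList (x :: xs) ^ (j + 1) • ⊤ : Submodule R M) := by
        refine Submodule.smul_mono_left (Ideal.pow_right_mono ?_ _) hq
        rw [Ideal.ofList_cons]
        exact le_sup_right
      have hz' : z = q + x • w := by rw [hw]; abel
      have h4 : x • y • w ∈ (Ideal.ofList (x :: xs) ^ (j + 1) • ⊤ : Submodule R M) := by
        have : x • y • w = y • z - y • q := by
          rw [hz', smul_add, smul_comm x y]; abel
        rw [this]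
        exact sub_mem hz (Submodule.smul_mem _ _ hq')
      have h5 := ihj _ (mem_pow_of_smul_mem_pow x xs hK j _ h4)
      rw [hz']
      refine add_mem hq' ?_
      exact pow_smul_le_comap x xs j h5

theorem length_quotient_pow_eq [IsNoetherianRing R] [IsLocalRing R] (xs : List R) :
    ∀ (M : Type _) [AddCommGroup M] [Module R M] [Module.Finite R M]
      (_ : ∀ x ∈ xs, x ∈ maximalIdeal R)
      (_ : RingTheory.Sequence.IsWeaklyRegular M xs) (n : ℕ),
      Module.length R (M ⧸ ((Ideal.ofList xs) ^ (n + 1) • ⊤ : Submodule R M)) =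
        Module.length R (M ⧸ (Ideal.ofList xs • ⊤ : Submodule R M)) *
          ((n + xs.length).choose xs.length : ℕ) := by
  induction xs with
  | nil => intro M _ _ _ _ _ n; rw [Ideal.ofList_nil, ← Ideal.zero_eq_bot,
      zero_pow n.succ_ne_zero]; simp
  | cons x xs ih =>
    intro M _ _ _ hm hr n
    have hK := mem_of_smul_mem_pow_of_isWeaklyRegular xs M x hm hr
    rw [RingTheory.Sequence.isWeaklyRegular_cons_iff] at hr
    induction n with
    | zero => rw [zero_add, pow_one]; simp
    | succ n ihn =>
      have hc : ((Ideal.ofList (x :: xs)) ^ (n + 1 + 1) • ⊤ : Submodule R M).comap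
          (LinearMap.lsmul R M x) = (Ideal.ofList (x :: xs)) ^ (n + 1) • ⊤ := by
        refine le_antisymm (fun w hw => ?_) (pow_smul_le_comap x xs (n + 1))
        exact mem_pow_of_smul_mem_pow x xs hK (n + 1) w hw
      rw [length_ofList_cons, hc, ihn, List.length_cons, choose_pascal, Nat.cast_add, mul_add,
        ih _ (fun a ha => hm a (List.mem_cons_of_mem _ ha)) hr.2, length_quotSMulTop_one]

end RegularPowers

section AssociatedPrimes

theorem ringKrullDim_quotient_add_one_le_of_lt {R : Type*} [CommRing R] {p q : Ideal R}
    [p.IsPrime] [q.IsPrime] (h : p < q) :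
    ringKrullDim (R ⧸ q) + 1 ≤ ringKrullDim (R ⧸ p) := by
  obtain ⟨a, haq, hap⟩ := SetLike.exists_of_lt h
  have ha : Ideal.Quotient.mk p a ∈ nonZeroDivisors (R ⧸ p) := by
    rw [mem_nonZeroDivisors_iff_ne_zero]
    rwa [Ne, Ideal.Quotient.eq_zero_iff_mem]
  refine le_trans (add_le_add_left (ringKrullDim_le_of_surjective
    (Ideal.Quotient.lift (Ideal.span {Ideal.Quotient.mk p a})
      (Ideal.Quotient.factor h.le) ?_) ?_) 1)
    (ringKrullDim_quotient_succ_le_of_nonZeroDivisor ha)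
  · intro x hx
    obtain ⟨c, rfl⟩ := Ideal.mem_span_singleton'.1 hx
    rw [map_mul, Ideal.Quotient.factor_mk, (Ideal.Quotient.eq_zero_iff_mem).2 haq, mul_zero]
  · exact Ideal.Quotient.lift_surjective_of_surjective _ _ (Ideal.Quotient.factor_surjective _)

theorem ringKrullDim_quotient_le_length {R : Type*} [CommRing R] [IsNoetherianRing R]
    [IsLocalRing R] (I : Ideal R) (hI : I ≤ maximalIdeal R) (ys : List R)
    (hy : ∀ y ∈ ys, y ∈ maximalIdeal R) (N : ℕ)
    (hN : maximalIdeal R ^ N ≤ I ⊔ Ideal.ofList ys) :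
    ringKrullDim (R ⧸ I) ≤ ys.length := by
  classical
  have : Nontrivial (R ⧸ I) := Ideal.Quotient.nontrivial_iff.2
    (ne_top_of_le_ne_top (maximalIdeal.isMaximal R).ne_top hI)
  have : IsLocalRing (R ⧸ I) := .of_surjective' (Ideal.Quotient.mk I) Ideal.Quotient.mk_surjective
  have hloc : IsLocalHom (Ideal.Quotient.mk I) :=
    IsLocalHom.of_surjective _ Ideal.Quotient.mk_surjective
  set S : Finset (R ⧸ I) := (ys.map (Ideal.Quotient.mk I)).toFinset with hS
  have hSJ : (S : Set (R ⧸ I)) ⊆ (Ring.jacobson (R ⧸ I) : Set (R ⧸ I)) := by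
    rw [IsLocalRing.ringJacobson_eq_maximalIdeal]
    intro s hs
    simp only [hS, List.coe_toFinset, List.mem_map, Set.mem_ofPred_eq] at hs
    obtain ⟨y, hys, rfl⟩ := hs
    exact map_nonunit (Ideal.Quotient.mk I) y (hy y hys)
  have hcard : S.card ≤ ys.length := by
    simpa using List.toFinset_card_le (ys.map (Ideal.Quotient.mk I))
  refine (ringKrullDim_le_ringKrullDim_quotient_add_card S hSJ).trans ?_
  have h0 : ringKrullDim ((R ⧸ I) ⧸ Ideal.span (S : Set (R ⧸ I))) ≤ 0 := by
    have : Ring.KrullDimLE 0 ((R ⧸ I) ⧸ Ideal.span (S : Set (R ⧸ I))) := by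
      rw [Ring.krullDimLE_zero_iff]
      intro P hP
      set φ : R →+* (R ⧸ I) ⧸ Ideal.span (S : Set (R ⧸ I)) :=
        (Ideal.Quotient.mk (Ideal.span (S : Set (R ⧸ I)))).comp (Ideal.Quotient.mk I) with hφ
      have hφs : Function.Surjective φ :=
        Ideal.Quotient.mk_surjective.comp Ideal.Quotient.mk_surjective
      have hle : I ⊔ Ideal.ofList ys ≤ P.comap φ := by
        refine sup_le (fun a ha => ?_) (Ideal.span_le.2 fun y hys => ?_)
        · simp [hφ, Ideal.mem_comap, Ideal.Quotient.eq_zero_iff_mem.2 ha]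
        · have : φ y = 0 := by
            rw [hφ, RingHom.comp_apply, Ideal.Quotient.eq_zero_iff_mem]
            refine Ideal.subset_span ?_
            simp only [hS, List.coe_toFinset, List.mem_map, Set.mem_ofPred_eq]
            exact ⟨y, hys, rfl⟩
          simp [this]
      have hprime : (P.comap φ).IsPrime := Ideal.comap_isPrime φ P
      have hm : maximalIdeal R ≤ P.comap φ := hprime.le_of_pow_le (hN.trans hle)
      have heq : P.comap φ = maximalIdeal R :=
        ((maximalIdeal.isMaximal R).eq_of_le hprime.ne_top hm).symm
      have hmax : (P.comap φ).IsMaximal := heq ▸ maximalIdeal.isMaximal R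
      have := Ideal.map_eq_top_or_isMaximal_of_surjective φ hφs hmax
      rw [Ideal.map_comap_of_surjective φ hφs] at this
      exact this.resolve_left hP.ne_top
    exact (Ring.krullDimLE_iff (n := 0)).1 this
  calc _ ≤ (0 : WithBot ℕ∞) + S.card := add_le_add_left h0 _
    _ ≤ _ := by rw [zero_add]; exact_mod_cast hcard

theorem length_le_ringKrullDim_quotient_of_mem_associatedPrimes {R : Type*} [CommRing R]
    [IsNoetherianRing R] [IsLocalRing R] (rs : List R) :
    ∀ (M : Type _) [AddCommGroup M] [Module R M] [Module.Finite R M]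
      (_ : ∀ x ∈ rs, x ∈ maximalIdeal R) (_ : RingTheory.Sequence.IsWeaklyRegular M rs)
      (p : Ideal R) (_ : p ∈ associatedPrimes R M), (rs.length : WithBot ℕ∞) ≤
      ringKrullDim (R ⧸ p) := by
  induction rs with
  | nil =>
    intro M _ _ _ _ _ p hp
    have := hp.isPrime
    simpa using ringKrullDim_nonneg_of_nontrivial
  | cons a rs ih =>
    intro M _ _ _ hm hr p hp
    rw [RingTheory.Sequence.isWeaklyRegular_cons_iff] at hr
    obtain ⟨hprime, x, hx⟩ := isAssociatedPrime_iff.1 hp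
    have ham : a ∈ maximalIdeal R := hm a List.mem_cons_self
    have hx0 : x ≠ 0 := by
      rintro rfl
      exact hprime.ne_top (by rw [hx, Ideal.eq_top_iff_one, Submodule.mem_colon_singleton]; simp)
    set Z := Submodule.torsionBySet R M (p : Set R) with hZ
    have hmemZ : ∀ z, z ∈ Z ↔ ∀ c ∈ p, c • z = 0 := by
      intro z
      rw [hZ, Submodule.mem_torsionBySet_iff]
      exact ⟨fun h c hc => h ⟨c, hc⟩, fun h c => h c c.2⟩
    have hxZ : x ∈ Z := by
      rw [hmemZ]
      intro c hc
      rw [hx, Submodule.mem_colon_singleton] at hc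
      simpa using hc
    have hnot : ¬ Z ≤ a • (⊤ : Submodule R M) := by
      intro hle
      have h1 : Z ≤ Ideal.span {a} • Z := by
        intro z hz
        obtain ⟨w, -, rfl⟩ := (Submodule.mem_smul_pointwise_iff_exists _ _ _).1 (hle hz)
        refine Submodule.smul_mem_smul (Ideal.mem_span_singleton_self a) ?_
        rw [hmemZ] at hz ⊢
        intro c hc
        exact hr.1.right_eq_zero_of_smul (by rw [smul_comm]; exact hz c hc)
      have h2 : Z = ⊥ := by
        refine Submodule.eq_bot_of_le_smul_of_le_jacobson_bot _ Z (IsNoetherian.noetherian Z) h1 ?_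
        rw [IsLocalRing.jacobson_eq_maximalIdeal _ bot_ne_top]
        exact (Ideal.span_singleton_le_iff_mem _).2 ham
      rw [h2, Submodule.mem_bot] at hxZ
      exact hx0 hxZ
    obtain ⟨z, hzZ, hza⟩ := SetLike.not_le_iff_exists.1 hnot
    have hz0 : (Submodule.Quotient.mk z : QuotSMulTop a M) ≠ 0 := by
      rwa [Ne, Submodule.Quotient.mk_eq_zero]
    obtain ⟨q, hq, hle⟩ := exists_le_isAssociatedPrime_of_isNoetherianRing R _ hz0
    have hqprime := hq.isPrime
    have hpq : p < q := by
      refine lt_of_le_of_ne (fun c hc => hle ?_) ?_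
      · rw [Submodule.mem_colon_singleton, ← Submodule.Quotient.mk_smul, (hmemZ z).1 hzZ c hc]
        simp
      · intro heq
        have haq : a ∈ q := by
          refine hle ?_
          rw [Submodule.mem_colon_singleton, ← Submodule.Quotient.mk_smul, Submodule.mem_bot,
            Submodule.Quotient.mk_eq_zero]
          exact Submodule.smul_mem_pointwise_smul _ _ _ trivial
        rw [← heq, hx, Submodule.mem_colon_singleton, Submodule.mem_bot] at haq
        exact hx0 (hr.1.right_eq_zero_of_smul haq)
    have := ih _ (fun y hy => hm y (List.mem_cons_of_mem _ hy)) hr.2 q hq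
    rw [List.length_cons, Nat.cast_add, Nat.cast_one]
    exact (add_le_add_left this 1).trans (ringKrullDim_quotient_add_one_le_of_lt hpq)

end AssociatedPrimes

section Exchange

universe u

open CategoryTheory CategoryTheory.Abelian RingTheory.Sequence

variable {R : Type u} [CommRing R] [IsLocalRing R]

theorem maximalIdeal_smul_top_lt_top (M : Type u) [AddCommGroup M] [Module R M]
    [Module.Finite R M] [Nontrivial M] : maximalIdeal R • (⊤ : Submodule R M) < ⊤ := by
  refine lt_top_iff_ne_top.2 fun h => ?_
  have := Submodule.eq_bot_of_le_smul_of_le_jacobson_bot (maximalIdeal R) (⊤ : Submodule R M)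
    Module.Finite.fg_top h.ge (IsLocalRing.jacobson_eq_maximalIdeal _ bot_ne_top).ge
  exact bot_ne_top this.symm

variable [IsNoetherianRing R]

theorem exists_isRegular_quotSMulTop (M : Type u) [AddCommGroup M] [Module R M]
    [Module.Finite R M] (rs : List R) (r : ℕ) (hlen : rs.length = r + 1)
    (hm : ∀ a ∈ rs, a ∈ maximalIdeal R) (hr : IsRegular M rs) (x : R) (hx : x ∈ maximalIdeal R)
    (hxr : IsSMulRegular M x) :
    ∃ ts : List R, ts.length = r ∧ (∀ a ∈ ts, a ∈ maximalIdeal R) ∧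
      IsRegular (QuotSMulTop x M) ts := by
  have : Nontrivial M := hr.nontrivial
  have : Nontrivial (QuotSMulTop x M) := nontrivial_quotSMulTop_of_mem_maximalIdeal M hx
  have hsupp : Module.support R (ModuleCat.of R (R ⧸ maximalIdeal R)) =
      PrimeSpectrum.zeroLocus (maximalIdeal R) := by
    rw [Module.support_eq_zeroLocus]
    exact congrArg _ (congrArg _ Ideal.annihilator_quotient)
  have hext := ModuleCat.subsingleton_ext_of_exists_isRegular (maximalIdeal R)
    (ModuleCat.of R (R ⧸ maximalIdeal R)) hsupp.subset (ModuleCat.of R M)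
    (maximalIdeal_smul_top_lt_top M) rs hm hr
  refine ModuleCat.exists_isRegular_of_exists_subsingleton_ext (maximalIdeal R) r
    (ModuleCat.of R (QuotSMulTop x M)) (maximalIdeal_smul_top_lt_top _)
    (ModuleCat.of R (R ⧸ maximalIdeal R)) hsupp fun i hi => ?_
  have zero1 := AddCommGrpCat.isZero_of_iff_subsingleton.mpr (hext i (by omega))
  have zero2 := AddCommGrpCat.isZero_of_iff_subsingleton.mpr (hext (i + 1) (by omega))
  have hxr' : IsSMulRegular (ModuleCat.of R M) x := hxr
  exact AddCommGrpCat.subsingleton_of_isZero <| ShortComplex.Exact.isZero_of_both_zeros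
    ((Ext.covariant_sequence_exact₃' (ModuleCat.of R (R ⧸ maximalIdeal R))
      hxr'.smulShortComplex_shortExact) i (i + 1) rfl)
    (zero1.eq_zero_of_src _) (zero2.eq_zero_of_tgt _)

theorem isWeaklyRegular_of_pow_le (ys : List R) :
    ∀ (M : Type u) [AddCommGroup M] [Module R M] [Module.Finite R M] (rs : List R)
      (_ : rs.length = ys.length) (_ : ∀ a ∈ rs, a ∈ maximalIdeal R) (_ : IsRegular M rs)
      (_ : ∀ a ∈ ys, a ∈ maximalIdeal R) (N : ℕ)
      (_ : maximalIdeal R ^ N ≤ Module.annihilator R M ⊔ Ideal.ofList ys),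
      IsWeaklyRegular M ys := by
  induction ys with
  | nil => intro M _ _ _ _ _ _ _ _ _ _; exact IsWeaklyRegular.nil R M
  | cons y ys ih =>
    intro M _ _ _ rs hlen hm hr hmy N hN
    have hym := hmy y List.mem_cons_self
    have hmys : ∀ a ∈ ys, a ∈ maximalIdeal R := fun a ha => hmy a (List.mem_cons_of_mem _ ha)
    have hyr : IsSMulRegular M y := by
      by_contra hcon
      have h1 : y ∈ ⋃ p ∈ associatedPrimes R M, (p : Set R) := by
        rw [biUnion_associatedPrimes_eq_compl_regular]
        exact hcon
      simp only [Set.mem_iUnion] at h1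
      obtain ⟨p, hp, hyp⟩ := h1
      have hle := length_le_ringKrullDim_quotient_of_mem_associatedPrimes rs M hm hr.1 p hp
      have hann : Module.annihilator R M ≤ p := by
        obtain ⟨_, x, hx⟩ := isAssociatedPrime_iff.1 hp
        intro c hc
        rw [hx, Submodule.mem_colon_singleton, Module.mem_annihilator.1 hc]
        simp
      have h2 := ringKrullDim_quotient_le_length p (le_maximalIdeal hp.isPrime.ne_top) ys hmys N
        (hN.trans (by
          rw [Ideal.ofList_cons, ← sup_assoc]
          exact sup_le_sup_right (sup_le hann ((Ideal.span_singleton_le_iff_mem _).2 hyp)) _))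
      have h3 := hle.trans h2
      rw [hlen, List.length_cons] at h3
      exact absurd h3 (by norm_cast; omega)
    rw [isWeaklyRegular_cons_iff]
    obtain ⟨ts, htl, htm, htr⟩ := exists_isRegular_quotSMulTop M rs ys.length
      (by rw [hlen, List.length_cons]) hm hr y hym hyr
    refine ⟨hyr, ih _ ts htl htm htr hmys N (hN.trans ?_)⟩
    rw [Ideal.ofList_cons, ← sup_assoc]
    refine sup_le_sup_right (sup_le ?_ ((Ideal.span_singleton_le_iff_mem _).2 ?_)) _
    · exact (Submodule.mkQ (y • ⊤ : Submodule R M)).annihilator_le_of_surjective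
        (Submodule.mkQ_surjective _)
    · exact QuotSMulTop.mem_annihilator M y

end Exchange

section Asymptotics

open Filter Topology

theorem tendsto_choose_div_choose_succ (j : ℕ) :
    Tendsto (fun n : ℕ => ((n + j).choose j : ℝ) / ((n + (j + 1)).choose (j + 1) : ℝ)) atTop
      (𝓝 0) := by
  have h : ∀ n : ℕ, ((n + j).choose j : ℝ) / ((n + (j + 1)).choose (j + 1) : ℝ) =
      ((j + 1 : ℕ) : ℝ) / ((n + (j + 1) : ℕ) : ℝ) := by
    intro n
    have h1 : (n + j + 1) * (n + j).choose j = (n + j + 1).choose (j + 1) * (j + 1) :=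
      Nat.add_one_mul_choose_eq _ _
    have h2 : (0 : ℝ) < ((n + (j + 1)).choose (j + 1) : ℝ) := by
      exact_mod_cast Nat.choose_pos (by omega)
    rw [div_eq_div_iff h2.ne' (by positivity)]
    rw [show n + (j + 1) = n + j + 1 by ring]
    exact_mod_cast (by linarith : (n + j).choose j * (n + j + 1) = (j + 1) * _)
  simp_rw [h]
  exact (tendsto_const_div_atTop_nhds_zero_nat ((j + 1 : ℕ) : ℝ)).comp
    (tendsto_add_atTop_nat (j + 1))

theorem tendsto_choose_div_choose (j k : ℕ) :
    Tendsto (fun n : ℕ => ((n + j).choose j : ℝ) / ((n + (j + k + 1)).choose (j + k + 1) : ℝ)) atTop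
      (𝓝 0) := by
  induction k with
  | zero => exact tendsto_choose_div_choose_succ j
  | succ k ih =>
    have := ih.mul (tendsto_choose_div_choose_succ (j + k + 1))
    rw [zero_mul] at this
    refine this.congr fun n => ?_
    have h2 : (0 : ℝ) < ((n + (j + k + 1)).choose (j + k + 1) : ℝ) := by
      exact_mod_cast Nat.choose_pos (by omega)
    rw [div_mul_div_cancel₀ h2.ne']
    rfl

theorem tendsto_sum_choose_div (D : ℕ) (e : ℕ → ℤ) :
    Tendsto (fun n : ℕ => (∑ i ∈ range D, (e i : ℝ) *
      ((n + (D - 1 - i)).choose (D - 1 - i) : ℝ)) / ((n + D).choose D : ℝ)) atTop (𝓝 0) := by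
  simp_rw [sum_div]
  rw [← sum_const_zero (s := range D)]
  refine tendsto_finsetSum _ fun i hi => ?_
  rw [mem_range] at hi
  have h := (tendsto_choose_div_choose (D - 1 - i) i).const_mul (e i : ℝ)
  rw [mul_zero, show D - 1 - i + i + 1 = D by omega] at h
  simpa only [mul_div_assoc] using h

theorem tendsto_div_choose_of_hilbert (D : ℕ) (e : ℕ → ℤ) (ℓ : ℕ) (r : ℕ → ℕ) (K : ℕ)
    (hr : ∀ n, r n ≤ K * (n + D).choose D)
    (h : ∀ᶠ n : ℕ in atTop, ((ℓ * (n + (D + 1)).choose (D + 1) + r n : ℕ) : ℤ) =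
      ∑ i ∈ range (D + 1 + 1), (-1 : ℤ) ^ i * e i * ((n + (D + 1) - i).choose (D + 1 - i))) :
    Tendsto (fun n => (r n : ℝ) / ((n + D).choose D : ℝ)) atTop (𝓝 (-(e 1 : ℝ))) := by
  have hpos : ∀ n j : ℕ, (0 : ℝ) < ((n + j).choose j : ℝ) := fun n j => by
    exact_mod_cast Nat.choose_pos (by omega)
  set f := fun i : ℕ => (-1 : ℤ) ^ i * e i with hf
  have h' : ∀ᶠ n : ℕ in atTop, (ℓ : ℝ) * ((n + (D + 1)).choose (D + 1) : ℝ) + r n =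
      (∑ i ∈ range D, (f (i + 2) : ℝ) * ((n + (D - 1 - i)).choose (D - 1 - i) : ℝ))
        - (e 1 : ℝ) * ((n + D).choose D : ℝ)
        + (e 0 : ℝ) * ((n + (D + 1)).choose (D + 1) : ℝ) := by
    filter_upwards [h] with n hn
    rw [sum_range_succ', sum_range_succ'] at hn
    have hn' := congrArg (Int.cast : ℤ → ℝ) hn
    push_cast at hn'
    rw [hn']
    congr 1
    · rw [sub_eq_add_neg]
      congr 1
      · refine sum_congr rfl fun i hi => ?_
        rw [mem_range] at hi
        simp only [hf]
        rw [show n + (D + 1) - (i + 1 + 1) = n + (D - 1 - i) by omega,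
          show D - (i + 1) = D - 1 - i by omega]
        push_cast
        ring
      · rw [show n + (D + 1) - (0 + 1) = n + D by omega]
        simp
    · simp
  have ht0 : Tendsto (fun n : ℕ => (∑ i ∈ range D, (f (i + 2) : ℝ) *
      ((n + (D - 1 - i)).choose (D - 1 - i) : ℝ)) / ((n + D).choose D : ℝ)) atTop (𝓝 0) :=
    tendsto_sum_choose_div D fun i => f (i + 2)
  have hsucc := tendsto_choose_div_choose_succ D
  have ht1 : Tendsto (fun n : ℕ => ((∑ i ∈ range D, (f (i + 2) : ℝ) *
      ((n + (D - 1 - i)).choose (D - 1 - i) : ℝ)) / ((n + D).choose D : ℝ)) *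
      (((n + D).choose D : ℝ) / ((n + (D + 1)).choose (D + 1) : ℝ))) atTop (𝓝 0) := by
    simpa using ht0.mul hsucc
  have hr0 : Tendsto (fun n : ℕ => (r n : ℝ) / ((n + (D + 1)).choose (D + 1) : ℝ)) atTop
      (𝓝 0) := by
    refine squeeze_zero (g := fun n : ℕ => (K : ℝ) * (((n + D).choose D : ℝ) /
      ((n + (D + 1)).choose (D + 1) : ℝ))) (fun n => by positivity) (fun n => ?_) ?_
    · rw [← mul_div_assoc]
      exact div_le_div_of_nonneg_right (by exact_mod_cast hr n) (hpos _ _).le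
    · simpa using hsucc.const_mul (K : ℝ)
  have he0 : (ℓ : ℝ) = e 0 := by
    have hl : Tendsto (fun _ : ℕ => (ℓ : ℝ) - e 0) atTop (𝓝 0) := by
      have := (ht1.sub (hsucc.const_mul (e 1 : ℝ))).sub hr0
      simp only [mul_zero, sub_zero] at this
      refine this.congr' ?_
      filter_upwards [h'] with n hn
      have p1 := hpos n D
      have p2 := hpos n (D + 1)
      field_simp
      linarith
    have := tendsto_nhds_unique hl tendsto_const_nhds
    linarith
  have := ht0.sub_const (e 1 : ℝ)
  rw [zero_sub] at this
  refine this.congr' ?_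
  filter_upwards [h'] with n hn
  have p1 := hpos n D
  rw [he0] at hn
  field_simp
  linarith

end Asymptotics

section Growth

variable {R : Type*} [CommRing R] [IsNoetherianRing R]

theorem exists_colon_sup_pow_le (p Q : Ideal R) [p.IsPrime] (y : R) (hy : y ∉ p) :
    ∃ c : ℕ, ∀ n : ℕ, Submodule.comap (LinearMap.lsmul R R y) (p ⊔ Q ^ (n + c)) ≤ p ⊔ Q ^ n := by
  obtain ⟨c, hc⟩ := Ideal.exists_pow_inf_eq_pow_smul Q
    (LinearMap.range (LinearMap.lsmul R (R ⧸ p) y))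
  have hpow : ∀ (j : ℕ) (a : R ⧸ p), a ∈ (Q ^ j • ⊤ : Submodule R (R ⧸ p)) ↔
      ∃ b ∈ Q ^ j, Submodule.Quotient.mk b = a := by
    intro j a
    have : (Q ^ j • ⊤ : Submodule R (R ⧸ p)) = Submodule.map (Submodule.mkQ p) (Q ^ j) := by
      conv_rhs => rw [← Ideal.mul_top (Q ^ j), ← smul_eq_mul]
      rw [Submodule.map_smul'', Submodule.map_top, Submodule.range_mkQ]
    rw [this]
    simp [Submodule.mem_map]
  refine ⟨c, fun n z hz => ?_⟩
  obtain ⟨a, ha, b, hb, hab⟩ := Submodule.mem_sup.1 hz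
  have h1 : (Submodule.Quotient.mk (y * z) : R ⧸ p) ∈ (Q ^ (n + c) • ⊤ : Submodule R (R ⧸ p)) ⊓
      LinearMap.range (LinearMap.lsmul R (R ⧸ p) y) := by
    refine ⟨(hpow _ _).2 ⟨b, hb, ?_⟩, ⟨Submodule.Quotient.mk z, rfl⟩⟩
    rw [Submodule.Quotient.eq, ← Submodule.neg_mem_iff]
    have : a = -(b - y * z) := by
      have : a + b = y * z := hab
      rw [← this]; ring
    rwa [← this]
  rw [hc _ (Nat.le_add_left c n), Nat.add_sub_cancel] at h1
  have h2 := Submodule.smul_mono (le_refl (Q ^ n)) (inf_le_right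
    (a := (Q ^ c • ⊤ : Submodule R (R ⧸ p)))) h1
  rw [LinearMap.range_eq_map, ← Submodule.map_smul''] at h2
  obtain ⟨w', hw', hw⟩ := h2
  obtain ⟨w, hwQ, rfl⟩ := (hpow _ _).1 hw'
  have h3 : y * (w - z) ∈ p := by
    rw [mul_sub]
    exact (Submodule.Quotient.eq _).1 hw
  have h4 := (Ideal.IsPrime.mem_or_mem inferInstance h3).resolve_left hy
  have h5 : z = -(w - z) + w := by ring
  rw [h5]
  exact Submodule.add_mem_sup (neg_mem h4) hwQ

theorem length_sup_pow_add_le (p q Q : Ideal R) [p.IsPrime] (hpq : p < q) :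
    ∃ c : ℕ, ∀ n : ℕ, Module.length R (R ⧸ (p ⊔ Q ^ n)) + Module.length R (R ⧸ (q ⊔ Q ^ (n + c))) ≤
      Module.length R (R ⧸ (p ⊔ Q ^ (n + c))) := by
  obtain ⟨y, hyq, hyp⟩ := SetLike.exists_of_lt hpq
  obtain ⟨c, hc⟩ := exists_colon_sup_pow_le p Q y hyp
  refine ⟨c, fun n => ?_⟩
  rw [length_colon y (p ⊔ Q ^ (n + c))]
  refine add_le_add (length_quotient_anti (hc n)) (length_quotient_anti ?_)
  refine sup_le (sup_le_sup_right hpq.le _) ?_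
  rw [← Submodule.ideal_span_singleton_smul, smul_eq_mul, Ideal.mul_top]
  exact ((Ideal.span_singleton_le_iff_mem _).2 hyq).trans le_sup_left

theorem mul_length_sup_pow_le (p q Q : Ideal R) [p.IsPrime] (hpq : p < q) :
    ∃ c : ℕ, ∀ n : ℕ, (n : ℕ∞) * Module.length R (R ⧸ (q ⊔ Q ^ n)) ≤
      Module.length R (R ⧸ (p ⊔ Q ^ (n * (c + 1)))) := by
  obtain ⟨c, hc⟩ := length_sup_pow_add_le p q Q hpq
  refine ⟨c, fun n => ?_⟩
  have h : ∀ m : ℕ, (m : ℕ∞) * Module.length R (R ⧸ (q ⊔ Q ^ n)) ≤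
      Module.length R (R ⧸ (p ⊔ Q ^ (n + m * c))) := by
    intro m
    induction m with
    | zero => simp
    | succ m ih =>
      have h1 := hc (n + m * c)
      rw [Nat.cast_add, add_mul, Nat.cast_one, one_mul,
        show n + (m + 1) * c = n + m * c + c by ring]
      refine le_trans (add_le_add ih (length_quotient_anti ?_)) h1
      exact sup_le_sup_left
        (Ideal.pow_le_pow_right (by rw [add_assoc]; exact Nat.le_add_right _ _)) _
  rw [show n * (c + 1) = n + n * c by ring]
  exact h n

variable [IsLocalRing R]

theorem ltSeries_length_le_of_length_le (Q : Ideal R) (hQ : Q ≤ maximalIdeal R) (D : ℕ) :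
    ∀ (p : Ideal R) [p.IsPrime] (K : ℕ)
      (_ : ∀ n ≥ 1, Module.length R (R ⧸ (p ⊔ Q ^ n)) ≤ ((K * n ^ D : ℕ) : ℕ∞))
      (s : LTSeries (PrimeSpectrum R)), p ≤ s.head.asIdeal → s.length ≤ D := by
  induction D with
  | zero =>
    intro p _ K hK s hs
    by_contra hlen
    rw [not_le] at hlen
    have hlt : p < (s ⟨1, by omega⟩).asIdeal := by
      refine hs.trans_lt ?_
      exact PrimeSpectrum.asIdeal_lt_asIdeal _ _ |>.2 (s.strictMono (by simp [Fin.lt_def]))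
    obtain ⟨c, hc⟩ := mul_length_sup_pow_le p _ Q hlt
    have h1 := (hc (K + 1)).trans (hK _ (Nat.mul_pos (by omega) (by omega)))
    have h2 : 1 ≤ Module.length R (R ⧸ ((s ⟨1, by omega⟩).asIdeal ⊔ Q ^ (K + 1))) := by
      rw [Order.one_le_iff_ne_zero, Ne, Module.length_eq_zero_iff, not_subsingleton_iff_nontrivial]
      refine Ideal.Quotient.nontrivial_iff.2 (ne_top_of_le_ne_top
        (maximalIdeal.isMaximal R).ne_top (sup_le (le_maximalIdeal ?_)
          ((Ideal.pow_le_self (by omega)).trans hQ)))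
      exact (s ⟨1, by omega⟩).isPrime.ne_top
    have h3 := (mul_le_mul_right h2 ((K + 1 : ℕ) : ℕ∞)).trans h1
    rw [mul_one, pow_zero, mul_one] at h3
    norm_cast at h3
    omega
  | succ D ih =>
    intro p _ K hK s hs
    by_cases hlen : s.length = 0
    · omega
    have hlt : p < (s ⟨1, by omega⟩).asIdeal := by
      refine hs.trans_lt ?_
      exact PrimeSpectrum.asIdeal_lt_asIdeal _ _ |>.2 (s.strictMono (by simp [Fin.lt_def]))
    obtain ⟨c, hc⟩ := mul_length_sup_pow_le p _ Q hlt
    have := ih (s ⟨1, by omega⟩).asIdeal (K * (c + 1) ^ (D + 1)) (fun n hn => ?_)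
      (s.tail hlen) (le_of_eq ?_)
    · have : (s.tail hlen).length = s.length - 1 := rfl
      omega
    · have h1 := (hc n).trans (hK _ (Nat.mul_pos hn (by omega)))
      have hne : Module.length R (R ⧸ ((s ⟨1, by omega⟩).asIdeal ⊔ Q ^ n)) ≠ ⊤ := by
        intro htop
        rw [htop, ENat.mul_top (by simp; omega)] at h1
        exact ENat.natCast_ne_top _ (top_le_iff.1 h1)
      obtain ⟨l, hl⟩ := ENat.ne_top_iff_exists.1 hne
      rw [← hl] at h1 ⊢
      norm_cast at h1 ⊢
      refine Nat.le_of_mul_le_mul_left (h1.trans (le_of_eq ?_)) hn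
      rw [mul_pow]
      ring
    · congr 1

theorem ringKrullDim_quotient_le_of_length_le (Q : Ideal R) (hQ : Q ≤ maximalIdeal R) (D : ℕ)
    (p : Ideal R) [p.IsPrime] (K : ℕ)
    (hK : ∀ n ≥ 1, Module.length R (R ⧸ (p ⊔ Q ^ n)) ≤ ((K * n ^ D : ℕ) : ℕ∞)) :
    ringKrullDim (R ⧸ p) ≤ D := by
  rw [ringKrullDim_quotient, Order.krullDim]
  refine iSup_le fun s => ?_
  have := ltSeries_length_le_of_length_le Q hQ D p K hK
    (s.map Subtype.val (Subtype.strictMono_coe _)) (s.head).2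
  exact_mod_cast this

end Growth

section Forms

open MvPolynomial

theorem dvd_of_forall_irreducible_exists {A : Type*} [CommRing A] [IsDomain A]
    [UniqueFactorizationMonoid A] (f₀ : A) (hf₀ : f₀ ≠ 0) :
    ∀ u : A, (∀ q, Irreducible q → ∃ f, ¬ q ∣ f ∧ f₀ ∣ f * u) → f₀ ∣ u := by
  induction f₀ using UniqueFactorizationMonoid.induction_on_prime with
  | h₁ => exact absurd rfl hf₀
  | h₂ x hx => exact fun u _ => hx.dvd
  | h₃ a p ha hp ih =>
    intro u hu
    obtain ⟨f, hpf, hf⟩ := hu p hp.irreducible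
    obtain ⟨v, rfl⟩ := (hp.dvd_or_dvd ((dvd_mul_right p a).trans hf)).resolve_left hpf
    refine mul_dvd_mul_left p (ih ha v fun q hq => ?_)
    obtain ⟨g, hqg, hg⟩ := hu q hq
    refine ⟨g, hqg, ?_⟩
    rw [mul_left_comm] at hg
    exact (mul_dvd_mul_iff_left hp.ne_zero).1 hg

variable (R k : Type*) [CommRing R] [Field k] [Algebra R k]

/-- The forms of degree `n` in `D + 1` variables over `k`, as an `R`-module. -/
noncomputable def formModule (D n : ℕ) : Submodule R (MvPolynomial (Fin (D + 1)) k) :=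
  (homogeneousSubmodule (Fin (D + 1)) k n).restrictScalars R

variable {k}

theorem mem_formModule {D n : ℕ} {f : MvPolynomial (Fin (D + 1)) k} :
    f ∈ formModule R k D n ↔ f.IsHomogeneous n := Iff.rfl

variable (k)

/-- A form is determined by its coefficients. -/
noncomputable def formModuleCoeff (D n : ℕ) : formModule R k D n →ₗ[R]
    ((Finset.univ : Finset (Fin (D + 1))).finsuppAntidiag n → k) where
  toFun f m := coeff m.1 f.1
  map_add' f g := by ext; simp
  map_smul' r f := by ext; simp

theorem formModuleCoeff_bijective (D n : ℕ) : Function.Bijective (formModuleCoeff R k D n) := by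
  have hmem : ∀ m : Fin (D + 1) →₀ ℕ,
      m ∈ (Finset.univ : Finset (Fin (D + 1))).finsuppAntidiag n ↔ m.degree = n := by
    intro m
    simp [Finset.mem_finsuppAntidiag, Finsupp.degree_eq_sum]
  constructor
  · rw [← LinearMap.ker_eq_bot, LinearMap.ker_eq_bot']
    intro f hf
    ext m
    by_cases hm : m.degree = n
    · exact congrFun hf ⟨m, (hmem m).2 hm⟩
    · simpa using ((mem_formModule R).1 f.2).coeff_eq_zero hm
  · intro c
    refine ⟨⟨∑ m, monomial m.1 (c m), ?_⟩, ?_⟩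
    · exact Submodule.sum_mem _ fun m _ => isHomogeneous_monomial _ ((hmem _).1 m.2)
    · ext m
      simp only [formModuleCoeff, LinearMap.coe_mk, AddHom.coe_mk, coeff_sum, coeff_monomial]
      rw [Finset.sum_eq_single m]
      · simp
      · intro b _ hb
        rw [if_neg (fun h => hb (Subtype.ext h))]
      · simp

theorem length_formModule (hk : Module.length R k = 1) (D n : ℕ) :
    Module.length R (formModule R k D n) = ((n + D).choose D : ℕ) := by
  rw [(LinearEquiv.ofBijective _ (formModuleCoeff_bijective R k D n)).length_eq,
    Module.length_pi_of_fintype]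
  simp only [hk, Finset.sum_const, Finset.card_univ, Fintype.card_coe,
    card_finsuppAntidiag_nat_eq_choose, Fintype.card_fin, nsmul_eq_mul, mul_one]
  rw [show D + 1 + n - 1 = n + D by omega, ← Nat.choose_symm_add]

variable {R k}

theorem le_length_of_mul_mem (hk : Module.length R k = 1) {D n : ℕ}
    (K : Submodule R (MvPolynomial (Fin (D + 1)) k)) (f : MvPolynomial (Fin (D + 1)) k)
    (hf : f ≠ 0) (hK : ∀ g, g.IsHomogeneous n → f * g ∈ K) :
    (((n + D).choose D : ℕ) : ℕ∞) ≤ Module.length R K := by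
  rw [← length_formModule R k hk]
  let φ : formModule R k D n →ₗ[R] K :=
    ((LinearMap.mulLeft R f).comp (formModule R k D n).subtype).codRestrict K
      (fun g => hK g.1 g.2)
  refine Module.length_le_of_injective φ ?_
  intro g g' h
  have := congrArg Subtype.val h
  exact Subtype.ext (mul_left_cancel₀ hf this)

theorem length_le_of_dvd (hk : Module.length R k = 1) {D n : ℕ}
    (K : Submodule R (MvPolynomial (Fin (D + 1)) k)) (q : MvPolynomial (Fin (D + 1)) k)
    (hq : Irreducible q) (hK : K ≤ formModule R k D (n + 1)) (hdvd : ∀ f ∈ K, q ∣ f) :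
    Module.length R K ≤ ((n + D).choose D : ℕ) := by
  have hq0 := hq.ne_zero
  have hpos : 1 ≤ q.totalDegree := by
    rw [Nat.one_le_iff_ne_zero]
    intro h
    rw [totalDegree_eq_zero_iff_eq_C] at h
    have hc : coeff 0 q ≠ 0 := by
      rintro hc
      rw [hc, C_0] at h
      exact hq0 h
    exact hq.not_isUnit (h ▸ (isUnit_iff_ne_zero.2 hc).map C)
  let L : Submodule R (MvPolynomial (Fin (D + 1)) k) := K.comap (LinearMap.mulLeft R q)
  have hL : Module.length R L = Module.length R K := by
    refine (LinearEquiv.ofBijective (((LinearMap.mulLeft R q).comp L.subtype).codRestrict K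
      (fun g => g.2)) ⟨?_, ?_⟩).length_eq
    · intro g g' h
      exact Subtype.ext (mul_left_cancel₀ hq0 (congrArg Subtype.val h))
    · rintro ⟨f, hf⟩
      obtain ⟨g, rfl⟩ := hdvd f hf
      exact ⟨⟨g, hf⟩, rfl⟩
  have hdeg : ∀ g ∈ L, g ≠ 0 → q.totalDegree + g.totalDegree = n + 1 := by
    intro g hg hg0
    rw [← totalDegree_mul_of_isDomain hq0 hg0]
    exact (hK hg : (q * g).IsHomogeneous (n + 1)).totalDegree (mul_ne_zero hq0 hg0)
  rw [← hL]
  by_cases ha : q.totalDegree ≤ n + 1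
  · refine le_trans (b := Module.length R (formModule R k D (n + 1 - q.totalDegree))) ?_ ?_
    · let φ : L →ₗ[R] formModule R k D (n + 1 - q.totalDegree) :=
        (((homogeneousComponent (n + 1 - q.totalDegree)).restrictScalars R).comp
          L.subtype).codRestrict _ (fun g => homogeneousComponent_isHomogeneous _ _)
      refine Module.length_le_of_injective φ ?_
      rw [← LinearMap.ker_eq_bot, LinearMap.ker_eq_bot']
      rintro ⟨g, hg⟩ h
      by_contra hne
      have hg0 : g ≠ 0 := fun h0 => hne (Subtype.ext h0)
      have h1 : homogeneousComponent (n + 1 - q.totalDegree) g = 0 := congrArg Subtype.val h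
      rw [show n + 1 - q.totalDegree = g.totalDegree by have := hdeg g hg hg0; omega] at h1
      obtain ⟨m, hm, hmd⟩ := Finset.exists_mem_eq_sup g.support
        (support_nonempty.2 hg0) (fun m => m.sum fun _ e => e)
      have h2 := congrArg (coeff m) h1
      rw [coeff_homogeneousComponent, coeff_zero, if_pos] at h2
      · exact mem_support_iff.1 hm h2
      · rw [totalDegree, hmd]; rfl
    · rw [length_formModule R k hk]
      exact_mod_cast Nat.choose_le_choose D (by omega)
  · have : L = ⊥ := by
      rw [Submodule.eq_bot_iff]
      intro g hg
      by_contra hg0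
      have := hdeg g hg hg0
      omega
    rw [this, Module.length_bot]
    exact zero_le

theorem eq_bot_of_dvd {D : ℕ}
    (K : Submodule R (MvPolynomial (Fin (D + 1)) k)) (q : MvPolynomial (Fin (D + 1)) k)
    (hq : Irreducible q) (hK : K ≤ formModule R k D 0) (hdvd : ∀ f ∈ K, q ∣ f) : K = ⊥ := by
  rw [Submodule.eq_bot_iff]
  intro f hf
  by_contra hf0
  have h0 : f.totalDegree = 0 := ((mem_formModule R).1 (hK hf)).totalDegree hf0
  rw [totalDegree_eq_zero_iff_eq_C] at h0
  have hc : coeff 0 f ≠ 0 := by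
    intro hc
    rw [hc, C_0] at h0
    exact hf0 h0
  have hu : IsUnit f := by
    rw [h0]
    exact (isUnit_iff_ne_zero.2 hc).map C
  exact hq.not_isUnit (isUnit_of_dvd_unit (hdvd f hf) hu)

/-- Dividing a form by a form, the quotient may be taken to be a form. -/
theorem exists_isHomogeneous_of_dvd {σ : Type*} {f u : MvPolynomial σ k} {b n : ℕ}
    (hf : f.IsHomogeneous b) (hu : u.IsHomogeneous (n + b)) (h : f ∣ u) :
    ∃ w : MvPolynomial σ k, w.IsHomogeneous n ∧ u = f * w := by
  obtain ⟨w, rfl⟩ := h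
  let _ : GradedAlgebra (homogeneousSubmodule σ k) := MvPolynomial.gradedAlgebra
  refine ⟨DirectSum.decompose (homogeneousSubmodule σ k) w n,
    (DirectSum.decompose (homogeneousSubmodule σ k) w n).2, ?_⟩
  rw [← DirectSum.coe_decompose_mul_add_of_left_mem (homogeneousSubmodule σ k) (i := b) hf,
    add_comm b n, DirectSum.decompose_of_mem_same (homogeneousSubmodule σ k) hu]

end Forms

/-- A filtration of a local ring refining the powers of an ideal `Q`, each of whose first `s`
steps is obtained by adding one socle element `a i` modulo the next step. -/
structure SocleFiltration {R : Type*} [CommRing R] [IsLocalRing R] (Q : Ideal R) where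
  /-- The number of steps between consecutive powers of `Q`. -/
  s : ℕ
  /-- The members of the filtration. -/
  W : ℕ → Ideal R
  /-- The generators of the successive quotients. -/
  a : ℕ → R
  s_pos : 0 < s
  W_zero : W 0 = ⊤
  W_add : ∀ t, W (t + s) = Q * W t
  W_eq : ∀ i < s, W i = W (i + 1) ⊔ Ideal.span {a i}
  maximalIdeal_mul_le : ∀ i < s, maximalIdeal R * W i ≤ W (i + 1)
  notMem : ∀ i < s, a i ∉ W (i + 1)

section Exists

variable {R : Type*} [CommRing R] [IsLocalRing R]

theorem exists_notMem_maximalIdeal_mul_le (I : Ideal R) (hI : I ≠ ⊤) (N : ℕ)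
    (hN : maximalIdeal R ^ N ≤ I) :
    ∃ a, a ∉ I ∧ maximalIdeal R * Ideal.span {a} ≤ I := by
  induction N with
  | zero => exact absurd (top_le_iff.1 (by simpa using hN)) hI
  | succ N ih =>
    by_cases h : maximalIdeal R ^ N ≤ I
    · exact ih h
    · obtain ⟨a, ha, haI⟩ := SetLike.not_le_iff_exists.1 h
      refine ⟨a, haI, le_trans (Ideal.mul_mono_right ?_) ((pow_succ' _ N).symm.le.trans hN)⟩
      exact (Ideal.span_singleton_le_iff_mem _).2 ha

theorem exists_socle_chain [IsNoetherianRing R] (I : Ideal R) (N : ℕ)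
    (hN : maximalIdeal R ^ N ≤ I) :
    ∃ (s : ℕ) (J : ℕ → Ideal R) (a : ℕ → R), J 0 = ⊤ ∧ J s = I ∧
      (∀ i < s, J i = J (i + 1) ⊔ Ideal.span {a i}) ∧
      (∀ i < s, maximalIdeal R * J i ≤ J (i + 1)) ∧ (∀ i < s, a i ∉ J (i + 1)) := by
  induction I using WellFoundedGT.induction with
  | ind I ih =>
    by_cases hI : I = ⊤
    · exact ⟨0, fun _ => ⊤, fun _ => 0, rfl, hI.symm, by simp, by simp, by simp⟩
    obtain ⟨b, hbI, hb⟩ := exists_notMem_maximalIdeal_mul_le I hI N hN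
    have hlt : I < I ⊔ Ideal.span {b} := by
      refine lt_of_le_of_ne le_sup_left fun h => hbI ?_
      rw [h]
      exact Ideal.mem_sup_right (Ideal.mem_span_singleton_self b)
    obtain ⟨s, J, a, h0, hs, h1, h2, h3⟩ := ih _ hlt (hN.trans hlt.le)
    refine ⟨s + 1, fun i => if i ≤ s then J i else I, fun i => if i < s then a i else b,
      by simpa using h0, by simp, ?_, ?_, ?_⟩
    · intro i hi
      rcases Nat.lt_or_eq_of_le (Nat.le_of_lt_succ hi) with h | rfl
      · simp only [if_pos h.le, if_pos h, if_pos (Nat.succ_le_of_lt h)]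
        exact h1 i h
      · simpa using hs
    · intro i hi
      rcases Nat.lt_or_eq_of_le (Nat.le_of_lt_succ hi) with h | rfl
      · simp only [if_pos h.le, if_pos (Nat.succ_le_of_lt h)]
        exact h2 i h
      · simp only [le_refl, if_true, hs, Ideal.mul_sup]
        rw [if_neg (by omega)]
        exact sup_le Ideal.mul_le_right hb
    · intro i hi
      rcases Nat.lt_or_eq_of_le (Nat.le_of_lt_succ hi) with h | rfl
      · simp only [if_pos h, if_pos (Nat.succ_le_of_lt h)]
        exact h3 i h
      · simpa using hbI

theorem nonempty_socleFiltration [IsNoetherianRing R] (Q : Ideal R) (hQ : Q ≤ maximalIdeal R)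
    (N : ℕ) (hN : maximalIdeal R ^ N ≤ Q) : Nonempty (SocleFiltration Q) := by
  obtain ⟨s, J, a, h0, hs, h1, h2, h3⟩ := exists_socle_chain Q N hN
  have hpos : 0 < s := by
    rw [Nat.pos_iff_ne_zero]
    rintro rfl
    exact (maximalIdeal.isMaximal R).ne_top (top_le_iff.1 (h0 ▸ hs ▸ hQ))
  have hW : ∀ i ≤ s, J (i % s) * Q ^ (i / s) = J i := by
    intro i hi
    rcases Nat.lt_or_eq_of_le hi with h | rfl
    · simp [Nat.mod_eq_of_lt h, Nat.div_eq_of_lt h]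
    · rw [Nat.mod_self, Nat.div_self hpos, h0, hs, pow_one, Ideal.top_mul]
  refine ⟨⟨s, fun t => J (t % s) * Q ^ (t / s), a, hpos, ?_, ?_, ?_, ?_, ?_⟩⟩
  · simp [h0]
  · intro t
    rw [Nat.add_mod_right, Nat.add_div_right _ hpos, pow_succ]
    ring
  · intro i hi
    rw [hW i hi.le, hW _ hi]
    exact h1 i hi
  · intro i hi
    rw [hW i hi.le, hW _ hi]
    exact h2 i hi
  · intro i hi
    rw [hW _ hi]
    exact h3 i hi

end Exists

namespace SocleFiltration

variable {R : Type*} [CommRing R] [IsLocalRing R] {Q : Ideal R} (𝓕 : SocleFiltration Q)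

/-- The generator of the `t`-th successive quotient. -/
def gen (t : ℕ) : R := 𝓕.a (t % 𝓕.s)

theorem W_add_mul (t n : ℕ) : 𝓕.W (t + n * 𝓕.s) = Q ^ n * 𝓕.W t := by
  induction n with
  | zero => simp
  | succ n ih =>
    rw [show t + (n + 1) * 𝓕.s = t + n * 𝓕.s + 𝓕.s by ring, W_add, ih, pow_succ']
    ring

theorem W_mul (n : ℕ) : 𝓕.W (n * 𝓕.s) = Q ^ n := by
  have := 𝓕.W_add_mul 0 n
  rwa [zero_add, 𝓕.W_zero, Ideal.mul_top] at this

theorem mod_add_div_mul (t : ℕ) : t % 𝓕.s + t / 𝓕.s * 𝓕.s = t := by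
  rw [mul_comm]; exact Nat.mod_add_div t 𝓕.s

theorem W_eq_sup (t : ℕ) :
    𝓕.W t = 𝓕.W (t + 1) ⊔ Q ^ (t / 𝓕.s) * Ideal.span {𝓕.gen t} := by
  have h := 𝓕.W_eq _ (Nat.mod_lt t 𝓕.s_pos)
  have h1 := 𝓕.W_add_mul (t % 𝓕.s) (t / 𝓕.s)
  have h2 := 𝓕.W_add_mul (t % 𝓕.s + 1) (t / 𝓕.s)
  rw [mod_add_div_mul] at h1
  rw [show t % 𝓕.s + 1 + t / 𝓕.s * 𝓕.s = t + 1 by have := 𝓕.mod_add_div_mul t; omega] at h2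
  rw [h1, h2, h, Ideal.mul_sup]
  rfl

theorem W_succ_le (t : ℕ) : 𝓕.W (t + 1) ≤ 𝓕.W t := by
  rw [𝓕.W_eq_sup t]; exact le_sup_left

theorem W_antitone : Antitone 𝓕.W := antitone_nat_of_succ_le 𝓕.W_succ_le

theorem maximalIdeal_mul_W_le (t : ℕ) : maximalIdeal R * 𝓕.W t ≤ 𝓕.W (t + 1) := by
  have h := 𝓕.maximalIdeal_mul_le _ (Nat.mod_lt t 𝓕.s_pos)
  have h1 := 𝓕.W_add_mul (t % 𝓕.s) (t / 𝓕.s)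
  have h2 := 𝓕.W_add_mul (t % 𝓕.s + 1) (t / 𝓕.s)
  rw [mod_add_div_mul] at h1
  rw [show t % 𝓕.s + 1 + t / 𝓕.s * 𝓕.s = t + 1 by have := 𝓕.mod_add_div_mul t; omega] at h2
  rw [h1, h2, mul_left_comm]
  exact Ideal.mul_mono_right h

theorem maximalIdeal_pow_le_W (t : ℕ) : maximalIdeal R ^ t ≤ 𝓕.W t := by
  induction t with
  | zero => rw [𝓕.W_zero]; exact le_top
  | succ t ih =>
    rw [pow_succ']
    exact (Ideal.mul_mono_right ih).trans (𝓕.maximalIdeal_mul_W_le t)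

theorem gen_add_mul (t b : ℕ) : 𝓕.gen (t + b * 𝓕.s) = 𝓕.gen t := by
  rw [gen, gen, Nat.add_mul_mod_self_right]

theorem add_mul_div (t b : ℕ) : (t + b * 𝓕.s) / 𝓕.s = t / 𝓕.s + b :=
  Nat.add_mul_div_right _ _ 𝓕.s_pos

end SocleFiltration

namespace SocleFiltration

open MvPolynomial

variable {R : Type*} [CommRing R] [IsLocalRing R] {σ : Type*} {x : σ → R}
  (𝓕 : SocleFiltration (Ideal.span (Set.range x)))

theorem eval_mul_mem_W {F : MvPolynomial σ R} {b : ℕ} (hF : F.IsHomogeneous b) {t : ℕ} {z : R}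
    (hz : z ∈ 𝓕.W t) : eval x F * z ∈ 𝓕.W (t + b * 𝓕.s) := by
  rw [W_add_mul]
  exact Ideal.mul_mem_mul ((Ideal.mem_span_pow_iff_exists_isHomogeneous x _).2 ⟨F, hF, rfl⟩) hz

theorem gen_mem_W_mod (t : ℕ) : 𝓕.gen t ∈ 𝓕.W (t % 𝓕.s) := by
  rw [𝓕.W_eq _ (Nat.mod_lt t 𝓕.s_pos)]
  exact Ideal.mem_sup_right (Ideal.mem_span_singleton_self _)

theorem eval_mul_gen_mem_W {U : MvPolynomial σ R} {t b : ℕ} (hU : U.IsHomogeneous (t / 𝓕.s + b)) :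
    eval x U * 𝓕.gen t ∈ 𝓕.W (t + b * 𝓕.s) := by
  have := 𝓕.eval_mul_mem_W hU (𝓕.gen_mem_W_mod t)
  rwa [add_mul, ← add_assoc, 𝓕.mod_add_div_mul] at this

theorem exists_sub_eval_mul_gen_mem {t b : ℕ} {z : R} (hz : z ∈ 𝓕.W (t + b * 𝓕.s)) :
    ∃ U : MvPolynomial σ R, U.IsHomogeneous (t / 𝓕.s + b) ∧
      z - eval x U * 𝓕.gen t ∈ 𝓕.W (t + b * 𝓕.s + 1) := by
  rw [𝓕.W_eq_sup, 𝓕.gen_add_mul, 𝓕.add_mul_div] at hz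
  obtain ⟨w, hw, v, hv, rfl⟩ := Submodule.mem_sup.1 hz
  obtain ⟨c, hc, rfl⟩ := Ideal.mem_mul_span_singleton.1 hv
  obtain ⟨U, hU, rfl⟩ := (Ideal.mem_span_pow_iff_exists_isHomogeneous x _).1 hc
  exact ⟨U, hU, by simpa using hw⟩

theorem eval_mul_gen_mem_of_map_eq_zero {U : MvPolynomial σ R} {t b : ℕ}
    (hU : U.IsHomogeneous (t / 𝓕.s + b)) (h0 : map (residue R) U = 0) :
    eval x U * 𝓕.gen t ∈ 𝓕.W (t + b * 𝓕.s + 1) := by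
  rw [U.as_sum, map_sum, Finset.sum_mul]
  refine Ideal.sum_mem _ fun m hm => 𝓕.maximalIdeal_mul_W_le _ ?_
  have h1 : coeff m U ∈ maximalIdeal R := by
    rw [← residue_eq_zero_iff, ← coeff_map, h0, coeff_zero]
  have h2 : eval x (monomial m (coeff m U)) * 𝓕.gen t =
      coeff m U * (eval x (monomial m 1) * 𝓕.gen t) := by
    rw [← mul_assoc, ← mul_one (coeff m U), ← C_mul_monomial, map_mul, eval_C, mul_one]
  rw [h2]
  refine Ideal.mul_mem_mul h1 (𝓕.eval_mul_gen_mem_W (isHomogeneous_monomial _ ?_))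
  by_contra hd
  exact mem_support_iff.1 hm (hU.coeff_eq_zero hd)

/-- The `i`-th strand of the associated graded module is torsion-free. -/
def IsFree (i : ℕ) : Prop :=
  ∀ (n : ℕ) (F : MvPolynomial σ R), F.IsHomogeneous n →
    eval x F * 𝓕.a i ∈ 𝓕.W (i + n * 𝓕.s + 1) → map (residue R) F = 0

/-- The `i`-th strand of the associated graded module has no component of codimension one. -/
def IsSmall (i : ℕ) : Prop :=
  ∀ q : MvPolynomial σ (ResidueField R), Irreducible q →
    ∃ (n : ℕ) (F : MvPolynomial σ R), F.IsHomogeneous n ∧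
      eval x F * 𝓕.a i ∈ 𝓕.W (i + n * 𝓕.s + 1) ∧ ¬ q ∣ map (residue R) F

theorem IsFree.map_eq_zero {𝓕 : SocleFiltration (Ideal.span (Set.range x))} {t : ℕ}
    (h : 𝓕.IsFree (t % 𝓕.s)) {U : MvPolynomial σ R} {b : ℕ}
    (hU : U.IsHomogeneous (t / 𝓕.s + b)) (hm : eval x U * 𝓕.gen t ∈ 𝓕.W (t + b * 𝓕.s + 1)) :
    map (residue R) U = 0 := by
  refine h _ U hU ?_
  rwa [add_mul, ← add_assoc (t % 𝓕.s), 𝓕.mod_add_div_mul]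

/-- The elements which lie in `W t` after multiplication by a form, for forms without a
common factor. -/
def sat (t : ℕ) : Ideal R where
  carrier := {z | ∀ q : MvPolynomial σ (ResidueField R), Irreducible q →
    ∃ (b : ℕ) (F : MvPolynomial σ R), F.IsHomogeneous b ∧ ¬ q ∣ map (residue R) F ∧
      eval x F * z ∈ 𝓕.W (t + b * 𝓕.s)}
  add_mem' := by
    intro y z hy hz q hq
    obtain ⟨b, F, hF, hqF, hFy⟩ := hy q hq
    obtain ⟨c, G, hG, hqG, hGz⟩ := hz q hq
    refine ⟨b + c, F * G, hF.mul hG, ?_, ?_⟩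
    · rw [map_mul]
      exact fun h => (hq.prime.dvd_or_dvd h).elim hqF hqG
    · have h1 := 𝓕.eval_mul_mem_W hG hFy
      have h2 := 𝓕.eval_mul_mem_W hF hGz
      rw [add_assoc, ← add_mul] at h1 h2
      rw [add_comm c b] at h2
      rw [map_mul, mul_add]
      refine add_mem ?_ ?_
      · rwa [mul_comm (eval x F), mul_assoc]
      · rwa [mul_assoc]
  zero_mem' := fun q hq =>
    ⟨0, 1, isHomogeneous_one _ _, by rw [map_one, ← isUnit_iff_dvd_one]; exact hq.not_isUnit,
      by simp⟩
  smul_mem' := by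
    intro c z hz q hq
    obtain ⟨b, F, hF, hqF, hFz⟩ := hz q hq
    refine ⟨b, F, hF, hqF, ?_⟩
    rw [smul_eq_mul, mul_left_comm]
    exact Ideal.mul_mem_left _ _ hFz

theorem W_le_sat (t : ℕ) : 𝓕.W t ≤ 𝓕.sat t := fun z hz q hq =>
  ⟨0, 1, isHomogeneous_one _ _, by rw [map_one, ← isUnit_iff_dvd_one]; exact hq.not_isUnit,
    by simpa using hz⟩

theorem sat_antitone : Antitone 𝓕.sat := by
  intro t t' h z hz q hq
  obtain ⟨b, F, hF, hqF, hFz⟩ := hz q hq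
  exact ⟨b, F, hF, hqF, 𝓕.W_antitone (by omega) hFz⟩

theorem sat_le_of_isSmall {t : ℕ} (ht : 𝓕.IsSmall (t % 𝓕.s)) : 𝓕.sat t ≤ 𝓕.sat (t + 1) := by
  intro z hz q hq
  obtain ⟨b, F, hF, hqF, hFz⟩ := hz q hq
  obtain ⟨c, G, hG, hGm, hqG⟩ := ht q hq
  obtain ⟨P, hP, hPm⟩ := 𝓕.exists_sub_eval_mul_gen_mem hFz
  refine ⟨b + c, F * G, hF.mul hG, ?_, ?_⟩
  · rw [map_mul]
    exact fun h => (hq.prime.dvd_or_dvd h).elim hqF hqG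
  · have h1 := 𝓕.eval_mul_mem_W hG hPm
    have h2 := 𝓕.eval_mul_mem_W hP hGm
    rw [show t + b * 𝓕.s + 1 + c * 𝓕.s = t + 1 + (b + c) * 𝓕.s by ring] at h1
    rw [show t % 𝓕.s + c * 𝓕.s + 1 + (t / 𝓕.s + b) * 𝓕.s =
      (t % 𝓕.s + t / 𝓕.s * 𝓕.s) + 1 + (b + c) * 𝓕.s by ring, 𝓕.mod_add_div_mul] at h2
    have h3 := add_mem h1 h2
    convert h3 using 1
    rw [map_mul, gen]
    ring

theorem exists_isHomogeneous_map_eq {w : MvPolynomial σ (ResidueField R)} {n : ℕ}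
    (hw : w.IsHomogeneous n) :
    ∃ V : MvPolynomial σ R, V.IsHomogeneous n ∧ map (residue R) V = w := by
  obtain ⟨V, rfl⟩ := map_surjective (residue R) residue_surjective w
  refine ⟨homogeneousComponent n V, homogeneousComponent_isHomogeneous _ _, ?_⟩
  ext m
  rw [coeff_map, coeff_homogeneousComponent]
  split_ifs with h
  · rw [coeff_map]
  · rw [map_zero, hw.coeff_eq_zero h]

theorem exists_sub_mem_sat_of_isFree [Nonempty σ] {t : ℕ} (ht : 𝓕.IsFree (t % 𝓕.s)) {z : R}
    (hz : z ∈ 𝓕.sat t) : ∃ w ∈ 𝓕.W t, z - w ∈ 𝓕.sat (t + 1) := by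
  obtain ⟨j⟩ := ‹Nonempty σ›
  obtain ⟨b₀, F₀, hF₀, hqF₀, hF₀z⟩ := hz _ (X_prime (R := ResidueField R) (i := j)).irreducible
  have hf₀ : map (residue R) F₀ ≠ 0 := fun h => hqF₀ (h ▸ dvd_zero _)
  obtain ⟨U₀, hU₀, hU₀m⟩ := 𝓕.exists_sub_eval_mul_gen_mem hF₀z
  have key : ∀ (b : ℕ) (F U : MvPolynomial σ R), F.IsHomogeneous b →
      U.IsHomogeneous (t / 𝓕.s + b) →
      eval x F * z - eval x U * 𝓕.gen t ∈ 𝓕.W (t + b * 𝓕.s + 1) →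
      map (residue R) F * map (residue R) U₀ = map (residue R) F₀ * map (residue R) U := by
    intro b F U hF hU hm
    have h1 := 𝓕.eval_mul_mem_W hF₀ hm
    have h2 := 𝓕.eval_mul_mem_W hF hU₀m
    rw [show t + b * 𝓕.s + 1 + b₀ * 𝓕.s = t + (b + b₀) * 𝓕.s + 1 by ring] at h1
    rw [show t + b₀ * 𝓕.s + 1 + b * 𝓕.s = t + (b + b₀) * 𝓕.s + 1 by ring] at h2
    rw [← map_mul, ← map_mul, ← sub_eq_zero, ← map_sub]
    refine ht.map_eq_zero (b := b + b₀) (IsHomogeneous.sub ?_ ?_) ?_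
    · convert hF.mul hU₀ using 1; ring
    · convert hF₀.mul hU using 1; ring
    · convert sub_mem h1 h2 using 1
      simp only [map_sub, map_mul]
      ring
  have hdvd : map (residue R) F₀ ∣ map (residue R) U₀ := by
    refine dvd_of_forall_irreducible_exists _ hf₀ _ fun q hq => ?_
    obtain ⟨b, F, hF, hqF, hFz⟩ := hz q hq
    obtain ⟨U, hU, hUm⟩ := 𝓕.exists_sub_eval_mul_gen_mem hFz
    exact ⟨_, hqF, ⟨_, key b F U hF hU hUm⟩⟩
  obtain ⟨w, hw, hwU⟩ := exists_isHomogeneous_of_dvd (hF₀.map _) (hU₀.map _) hdvd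
  obtain ⟨V, hV, rfl⟩ := exists_isHomogeneous_map_eq hw
  refine ⟨eval x V * 𝓕.gen t, ?_, fun q hq => ?_⟩
  · simpa using 𝓕.eval_mul_gen_mem_W (b := 0) (by simpa using hV)
  obtain ⟨b, F, hF, hqF, hFz⟩ := hz q hq
  obtain ⟨U, hU, hUm⟩ := 𝓕.exists_sub_eval_mul_gen_mem hFz
  refine ⟨b, F, hF, hqF, ?_⟩
  have h1 := key b F U hF hU hUm
  rw [hwU, mul_left_comm] at h1
  have h2 := mul_left_cancel₀ hf₀ h1
  have h3 : map (residue R) (U - F * V) = 0 := by rw [map_sub, map_mul, h2, sub_self]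
  have h4 := 𝓕.eval_mul_gen_mem_of_map_eq_zero (hU.sub (by convert hF.mul hV using 1; ring)) h3
  rw [show t + 1 + b * 𝓕.s = t + b * 𝓕.s + 1 by ring]
  convert add_mem hUm h4 using 1
  simp only [map_sub, map_mul]
  ring

theorem exists_sub_mem_sat [Nonempty σ]
    (h : ∀ i < 𝓕.s, ¬ 𝓕.IsFree i → 𝓕.IsSmall i) (t : ℕ) {z : R}
    (hz : z ∈ 𝓕.sat t) : ∃ w ∈ 𝓕.W t, z - w ∈ 𝓕.sat (t + 1) := by
  by_cases ht : 𝓕.IsFree (t % 𝓕.s)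
  · exact 𝓕.exists_sub_mem_sat_of_isFree ht hz
  · refine ⟨0, zero_mem _, ?_⟩
    rw [sub_zero]
    exact 𝓕.sat_le_of_isSmall (h _ (Nat.mod_lt t 𝓕.s_pos) ht) hz

/-- Elements of the intersection of the ideals `sat t` have no initial form in a free strand. -/
theorem mem_W_succ_of_mem_sat [Nonempty σ] {t : ℕ} (ht : 𝓕.IsFree (t % 𝓕.s)) {y : R}
    (hy : y ∈ 𝓕.sat (t + 1)) (hyW : y ∈ 𝓕.W t) : y ∈ 𝓕.W (t + 1) := by
  obtain ⟨j⟩ := ‹Nonempty σ›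
  obtain ⟨b, F, hF, hqF, hFy⟩ := hy _ (X_prime (R := ResidueField R) (i := j)).irreducible
  have hf : map (residue R) F ≠ 0 := fun h => hqF (h ▸ dvd_zero _)
  obtain ⟨U, hU, hUm⟩ := 𝓕.exists_sub_eval_mul_gen_mem (t := t) (b := 0) (by simpa using hyW)
  rw [zero_mul, add_zero] at hUm
  have h1 := 𝓕.eval_mul_mem_W hF hUm
  have h2 := ht.map_eq_zero (U := F * U) (b := b) (by convert hF.mul hU using 1; ring) (by
    rw [show t + b * 𝓕.s + 1 = t + 1 + b * 𝓕.s by ring]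
    convert sub_mem hFy h1 using 1
    rw [map_mul]
    ring)
  rw [map_mul] at h2
  have h3 := (mul_eq_zero.1 h2).resolve_left hf
  have h4 := 𝓕.eval_mul_gen_mem_of_map_eq_zero hU h3
  rw [zero_mul, add_zero] at h4
  simpa using add_mem hUm h4

end SocleFiltration

theorem length_range_eq_add {R A X P : Type*} [CommRing R] [AddCommGroup A] [Module R A]
    [AddCommGroup X] [Module R X] [AddCommGroup P] [Module R P] (f : A →ₗ[R] X) (g : A →ₗ[R] P)
    (hf : Function.Surjective f) (h : LinearMap.ker g ≤ LinearMap.ker f) :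
    Module.length R (LinearMap.range g) =
      Module.length R (Submodule.map g (LinearMap.ker f)) + Module.length R X := by
  rw [← g.quotKerEquivRange.length_eq, length_quotient_eq_add h,
    (f.quotKerEquivOfSurjective hf).length_eq, ← LinearMap.range_domRestrict,
    ← (g.domRestrict (LinearMap.ker f)).quotKerEquivRange.length_eq]
  rfl

theorem IsLocalRing.length_residueField (R : Type*) [CommRing R] [IsLocalRing R] :
    Module.length R (ResidueField R) = 1 := by
  rw [Module.length_eq_of_surjective (S := R) (R := ResidueField R) (M := ResidueField R)
    residue_surjective, Module.length_eq_one]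

namespace SocleFiltration

open MvPolynomial

variable {R : Type*} [CommRing R] [IsLocalRing R] {D : ℕ} {x : Fin (D + 1) → R}
  (𝓕 : SocleFiltration (Ideal.span (Set.range x)))

/-- The successive quotients of the filtration. -/
abbrev Gr (t : ℕ) : Type _ := 𝓕.W t ⧸ Submodule.comap (Submodule.subtype (𝓕.W t)) (𝓕.W (t + 1))

/-- Reduction of the coefficients of forms. -/
noncomputable def reduceForm (R : Type*) [CommRing R] [IsLocalRing R] (D n : ℕ) :
    homogeneousSubmodule (Fin (D + 1)) R n →ₗ[R] MvPolynomial (Fin (D + 1)) (ResidueField R) :=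
  (mapAlgHom (Algebra.ofId R (ResidueField R))).toLinearMap.comp (Submodule.subtype _)

theorem range_reduceForm (n : ℕ) :
    LinearMap.range (reduceForm R D n) = formModule R (ResidueField R) D n := by
  ext w
  constructor
  · rintro ⟨F, rfl⟩
    exact IsHomogeneous.map F.2 _
  · intro hw
    obtain ⟨V, hV, rfl⟩ := exists_isHomogeneous_map_eq hw
    exact ⟨⟨V, hV⟩, rfl⟩

/-- The presentation of a successive quotient by forms. -/
noncomputable def evalForm (t : ℕ) :
    homogeneousSubmodule (Fin (D + 1)) R (t / 𝓕.s) →ₗ[R] 𝓕.Gr t :=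
  (Submodule.mkQ _).comp
    (LinearMap.codRestrict (𝓕.W t)
      (((LinearMap.mulRight R (𝓕.gen t)).comp (aeval x).toLinearMap).comp (Submodule.subtype _))
      (fun F => by simpa [aeval_eq_eval] using
        𝓕.eval_mul_gen_mem_W (b := 0) (show F.1.IsHomogeneous (t / 𝓕.s + 0) from F.2)))

theorem mem_ker_evalForm {t : ℕ} (F : homogeneousSubmodule (Fin (D + 1)) R (t / 𝓕.s)) :
    F ∈ LinearMap.ker (𝓕.evalForm t) ↔ eval x F.1 * 𝓕.gen t ∈ 𝓕.W (t + 1) := by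
  rw [LinearMap.mem_ker, evalForm, LinearMap.comp_apply, Submodule.mkQ_apply,
    Submodule.Quotient.mk_eq_zero]
  rfl

theorem evalForm_surjective (t : ℕ) : Function.Surjective (𝓕.evalForm t) := by
  intro y
  obtain ⟨⟨z, hz⟩, rfl⟩ := Submodule.mkQ_surjective _ y
  obtain ⟨U, hU, hUm⟩ := 𝓕.exists_sub_eval_mul_gen_mem (t := t) (b := 0) (by simpa using hz)
  rw [zero_mul, add_zero] at hUm
  refine ⟨⟨U, hU⟩, ?_⟩
  rw [evalForm, LinearMap.comp_apply]
  refine (Submodule.Quotient.eq _).2 ?_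
  rw [← Submodule.neg_mem_iff, neg_sub]
  exact hUm

/-- The reductions of the forms vanishing on a successive quotient. -/
noncomputable def relations (t : ℕ) : Submodule R (MvPolynomial (Fin (D + 1)) (ResidueField R)) :=
  Submodule.map (reduceForm R D (t / 𝓕.s)) (LinearMap.ker (𝓕.evalForm t))

theorem mem_relations {t : ℕ} {f : MvPolynomial (Fin (D + 1)) (ResidueField R)} :
    f ∈ 𝓕.relations t ↔ ∃ F : MvPolynomial (Fin (D + 1)) R, F.IsHomogeneous (t / 𝓕.s) ∧
      eval x F * 𝓕.gen t ∈ 𝓕.W (t + 1) ∧ map (residue R) F = f := by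
  constructor
  · rintro ⟨F, hF, rfl⟩
    exact ⟨F.1, F.2, (𝓕.mem_ker_evalForm F).1 hF, rfl⟩
  · rintro ⟨F, hF, hFm, rfl⟩
    exact ⟨⟨F, hF⟩, (𝓕.mem_ker_evalForm _).2 hFm, rfl⟩

theorem length_relations_add_length_gr (t : ℕ) :
    Module.length R (𝓕.relations t) + Module.length R (𝓕.Gr t) =
      ((t / 𝓕.s + D).choose D : ℕ) := by
  rw [relations, ← length_range_eq_add _ _ (𝓕.evalForm_surjective t), range_reduceForm,
    length_formModule R _ (length_residueField R)]
  intro F hF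
  rw [mem_ker_evalForm]
  simpa using 𝓕.eval_mul_gen_mem_of_map_eq_zero (b := 0)
    (show F.1.IsHomogeneous (t / 𝓕.s + 0) from F.2) hF

theorem relations_le (t : ℕ) :
    𝓕.relations t ≤ formModule R (ResidueField R) D (t / 𝓕.s) := by
  rw [← range_reduceForm]
  exact LinearMap.map_le_range

/-- The Hilbert function of the filtration. -/
noncomputable def hilb (t : ℕ) : ℕ := (Module.length R (𝓕.Gr t)).toNat

theorem length_gr (t : ℕ) : Module.length R (𝓕.Gr t) = (𝓕.hilb t : ℕ∞) := by
  refine (ENat.natCast_toNat fun h => ?_).symm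
  have := 𝓕.length_relations_add_length_gr t
  rw [h, add_top] at this
  exact ENat.natCast_ne_top _ this.symm

theorem length_quotient_W (t : ℕ) :
    Module.length R (R ⧸ 𝓕.W t) = ((∑ j ∈ range t, 𝓕.hilb j : ℕ) : ℕ∞) := by
  induction t with
  | zero =>
    rw [range_zero, sum_empty, Nat.cast_zero, Module.length_eq_zero_iff, 𝓕.W_zero]
    exact Ideal.Quotient.subsingleton_iff.2 rfl
  | succ t ih =>
    rw [length_quotient_eq_add (𝓕.W_succ_le t), ih, sum_range_succ, Nat.cast_add, add_comm]
    congr 1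
    exact 𝓕.length_gr t

theorem hilb_of_isFree {t : ℕ} (ht : 𝓕.IsFree (t % 𝓕.s)) :
    𝓕.hilb t = (t / 𝓕.s + D).choose D := by
  have h := 𝓕.length_relations_add_length_gr t
  have h0 : 𝓕.relations t = ⊥ := by
    rw [Submodule.eq_bot_iff]
    intro f hf
    obtain ⟨F, hF, hFm, rfl⟩ := 𝓕.mem_relations.1 hf
    exact ht.map_eq_zero (b := 0) hF (by simpa using hFm)
  rw [h0, Module.length_bot, zero_add, length_gr] at h
  exact_mod_cast h

theorem hilb_le (t : ℕ) : 𝓕.hilb t ≤ (t / 𝓕.s + D).choose D := by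
  have h := 𝓕.length_relations_add_length_gr t
  rw [length_gr] at h
  exact_mod_cast (le_add_self.trans h.le)

theorem exists_hilb_add_le_of_not_isFree {i : ℕ} (hi : i < 𝓕.s) (h : ¬ 𝓕.IsFree i) :
    ∃ a : ℕ, ∀ n : ℕ, 𝓕.hilb (i + (n + a) * 𝓕.s) + (n + D).choose D ≤ (n + a + D).choose D := by
  rw [IsFree] at h
  push Not at h
  obtain ⟨a, F, hF, hFm, hF0⟩ := h
  refine ⟨a, fun n => ?_⟩
  have h1 := 𝓕.length_relations_add_length_gr (i + (n + a) * 𝓕.s)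
  rw [length_gr, 𝓕.add_mul_div, Nat.div_eq_of_lt hi, zero_add] at h1
  have h2 := le_length_of_mul_mem (length_residueField R) (n := n)
    (𝓕.relations (i + (n + a) * 𝓕.s)) _ hF0 (fun g hg => ?_)
  · have := (add_le_add_left h2 _).trans h1.le
    rw [add_comm]
    exact_mod_cast this
  · obtain ⟨G, hG, rfl⟩ := exists_isHomogeneous_map_eq hg
    rw [mem_relations]
    refine ⟨F * G, ?_, ?_, map_mul _ _ _⟩
    · rw [𝓕.add_mul_div, Nat.div_eq_of_lt hi, zero_add, add_comm n a]
      exact hF.mul hG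
    · have := 𝓕.eval_mul_mem_W hG hFm
      rw [show i + a * 𝓕.s + 1 + n * 𝓕.s = i + (n + a) * 𝓕.s + 1 by ring] at this
      rw [gen_add_mul, gen, Nat.mod_eq_of_lt hi, map_mul]
      convert this using 1
      ring

theorem dvd_of_mem_relations {i : ℕ} (hi : i < 𝓕.s)
    {q : MvPolynomial (Fin (D + 1)) (ResidueField R)}
    (hq : ∀ (n : ℕ) (F : MvPolynomial (Fin (D + 1)) R), F.IsHomogeneous n →
      eval x F * 𝓕.a i ∈ 𝓕.W (i + n * 𝓕.s + 1) → q ∣ map (residue R) F) (n : ℕ) :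
    ∀ f ∈ 𝓕.relations (i + n * 𝓕.s), q ∣ f := by
  intro f hf
  obtain ⟨F, hF, hFm, rfl⟩ := 𝓕.mem_relations.1 hf
  rw [𝓕.add_mul_div, Nat.div_eq_of_lt hi, zero_add] at hF
  rw [gen_add_mul, gen, Nat.mod_eq_of_lt hi] at hFm
  exact hq n F hF hFm

theorem le_sum_hilb_of_not_isSmall {i : ℕ} (hi : i < 𝓕.s) (h : ¬ 𝓕.IsSmall i) (n : ℕ) :
    (n + D).choose D ≤ ∑ j ∈ range (n + 1), 𝓕.hilb (i + j * 𝓕.s) := by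
  rw [IsSmall] at h
  push Not at h
  obtain ⟨q, hq, hdvd⟩ := h
  have hle : ∀ n, 𝓕.relations (i + n * 𝓕.s) ≤ formModule R (ResidueField R) D n := by
    intro n
    have := 𝓕.relations_le (i + n * 𝓕.s)
    rwa [𝓕.add_mul_div, Nat.div_eq_of_lt hi, zero_add] at this
  have heq : ∀ n, Module.length R (𝓕.relations (i + n * 𝓕.s)) + 𝓕.hilb (i + n * 𝓕.s) =
      ((n + D).choose D : ℕ) := by
    intro n
    have := 𝓕.length_relations_add_length_gr (i + n * 𝓕.s)
    rwa [length_gr, 𝓕.add_mul_div, Nat.div_eq_of_lt hi, zero_add] at this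
  induction n with
  | zero =>
    have h0 := eq_bot_of_dvd _ q hq (hle 0) (𝓕.dvd_of_mem_relations hi hdvd 0)
    have h1 := heq 0
    rw [h0, Module.length_bot, zero_add] at h1
    rw [sum_range_one]
    exact le_of_eq (by exact_mod_cast h1.symm)
  | succ n ih =>
    have h0 := length_le_of_dvd (length_residueField R) _ q hq (hle (n + 1))
      (𝓕.dvd_of_mem_relations hi hdvd (n + 1))
    have h1 := (heq (n + 1)).symm.le.trans (add_le_add_left h0 _)
    rw [sum_range_succ]
    refine le_trans ?_ (Nat.add_le_add_right ih _)
    exact_mod_cast h1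

theorem sum_hilb_le_of_not_isFree {i : ℕ} (hi : i < 𝓕.s) (h : ¬ 𝓕.IsFree i) :
    ∃ a : ℕ, ∀ n : ℕ, ∑ j ∈ range (n + 1), 𝓕.hilb (i + j * 𝓕.s) ≤ a * (n + D).choose D := by
  obtain ⟨a, ha⟩ := 𝓕.exists_hilb_add_le_of_not_isFree hi h
  have hle : ∀ j, 𝓕.hilb (i + j * 𝓕.s) ≤ (j + D).choose D := by
    intro j
    have := 𝓕.hilb_le (i + j * 𝓕.s)
    rwa [𝓕.add_mul_div, Nat.div_eq_of_lt hi, zero_add] at this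
  have hsum : ∀ m : ℕ, ∑ j ∈ range (m + a), 𝓕.hilb (i + j * 𝓕.s) +
      ∑ j ∈ range m, (j + D).choose D ≤ ∑ j ∈ range (m + a), (j + D).choose D := by
    intro m
    induction m with
    | zero => simpa using sum_le_sum fun j _ => hle j
    | succ m ih =>
      rw [show m + 1 + a = m + a + 1 by ring, sum_range_succ, sum_range_succ,
        sum_range_succ _ (m + a)]
      have := ha m
      omega
  refine ⟨a, fun n => ?_⟩
  rcases le_total a (n + 1) with han | han
  · obtain ⟨m, hm⟩ := Nat.exists_eq_add_of_le' han
    have h1 := hsum m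
    rw [sum_range_add (fun j => (j + D).choose D) m a, ← hm, add_comm] at h1
    have h2 := (Nat.add_le_add_iff_left.1 h1).trans
      (sum_le_card_nsmul (range a) _ ((n + D).choose D) fun j hj => ?_)
    · simpa using h2
    · exact Nat.choose_le_choose _ (by have := mem_range.1 hj; omega)
  · refine (sum_le_card_nsmul _ _ ((n + D).choose D) fun j hj => (hle j).trans
      (Nat.choose_le_choose _ (by have := mem_range.1 hj; omega))).trans ?_
    rw [card_range, smul_eq_mul]
    exact Nat.mul_le_mul_right _ han

end SocleFiltration

theorem sum_range_mul_eq {M : Type*} [AddCommMonoid M] (g : ℕ → M) (m s : ℕ) :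
    ∑ t ∈ range (m * s), g t = ∑ i ∈ range s, ∑ j ∈ range m, g (i + j * s) := by
  induction m with
  | zero => simp
  | succ m ih =>
    rw [add_mul, one_mul, Finset.sum_range_add, ih, ← sum_add_distrib]
    refine sum_congr rfl fun i _ => ?_
    rw [sum_range_succ, add_comm i]

theorem sum_range_choose_add (n D : ℕ) :
    ∑ j ∈ range (n + 1), (j + D).choose D = (n + (D + 1)).choose (D + 1) := by
  induction n with
  | zero => simp
  | succ n ih => rw [sum_range_succ, ih, choose_pascal]

namespace SocleFiltration

open MvPolynomial

section Limit

variable {R : Type*} [CommRing R] [IsLocalRing R] {Q : Ideal R} (𝓕 : SocleFiltration Q)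

theorem exists_sub_mem_W [IsAdicComplete (maximalIdeal R) R] (hQ : Q ≤ maximalIdeal R) (t₀ : ℕ)
    (z : ℕ → R) (hz : ∀ n, z (n + 1) - z n ∈ 𝓕.W (t₀ + n)) :
    ∃ L, ∀ n, L - z n ∈ 𝓕.W (t₀ + n) := by
  have hmn : ∀ n j, z (n + j) - z n ∈ 𝓕.W (t₀ + n) := by
    intro n j
    induction j with
    | zero => simp
    | succ j ih =>
      have := add_mem (𝓕.W_antitone (by omega) (hz (n + j))) ih
      rwa [sub_add_sub_cancel] at this
  obtain ⟨L, hL⟩ := IsPrecomplete.prec' (I := maximalIdeal R) (fun n => z (n * 𝓕.s)) (by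
    intro m n hmn'
    refine SModEq.symm (SModEq.sub_mem.2 ?_)
    obtain ⟨j, rfl⟩ := Nat.exists_eq_add_of_le hmn'
    have := 𝓕.W_antitone (Nat.le_add_left _ _) (hmn (m * 𝓕.s) (j * 𝓕.s))
    rw [𝓕.W_mul, ← add_mul] at this
    rw [smul_eq_mul, Ideal.mul_top]
    exact Ideal.pow_right_mono hQ m this)
  refine ⟨L, fun n => ?_⟩
  have h1 := SModEq.sub_mem.1 (hL (t₀ + n)).symm
  rw [smul_eq_mul, Ideal.mul_top] at h1
  have h2 := add_mem (𝓕.maximalIdeal_pow_le_W _ h1)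
    (hmn n ((t₀ + n) * 𝓕.s - n))
  have h3 : n ≤ (t₀ + n) * 𝓕.s :=
    (Nat.le_add_left n t₀).trans (Nat.le_mul_of_pos_right _ 𝓕.s_pos)
  rwa [Nat.add_sub_cancel' h3, sub_add_sub_cancel] at h2

end Limit

variable {R : Type*} [CommRing R] [IsLocalRing R] {D : ℕ} {x : Fin (D + 1) → R}
  (𝓕 : SocleFiltration (Ideal.span (Set.range x)))

open Classical in
/-- The contribution of the strands which are not free to the length of `R ⧸ W t`. -/
noncomputable def rest (t : ℕ) : ℕ :=
  ∑ j ∈ range t, if 𝓕.IsFree (j % 𝓕.s) then 0 else 𝓕.hilb j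

open Classical in
/-- The number of free strands. -/
noncomputable def freeRank : ℕ := Finset.card {i ∈ range 𝓕.s | 𝓕.IsFree i}

open Classical in
theorem sum_hilb_eq (n : ℕ) :
    ∑ t ∈ range ((n + 1) * 𝓕.s), 𝓕.hilb t =
      𝓕.freeRank * (n + (D + 1)).choose (D + 1) + 𝓕.rest ((n + 1) * 𝓕.s) := by
  have h : ∀ t, 𝓕.hilb t = (if 𝓕.IsFree (t % 𝓕.s) then (t / 𝓕.s + D).choose D else 0) +
      (if 𝓕.IsFree (t % 𝓕.s) then 0 else 𝓕.hilb t) := by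
    intro t
    split_ifs with ht
    · rw [add_zero, 𝓕.hilb_of_isFree ht]
    · rw [zero_add]
  rw [sum_congr rfl fun t _ => h t, sum_add_distrib, ← rest]
  congr 1
  rw [sum_range_mul_eq, freeRank, card_filter, sum_mul]
  refine sum_congr rfl fun i hi => ?_
  rw [mem_range] at hi
  rw [ite_mul, one_mul, zero_mul, ← sum_range_choose_add]
  simp only [Nat.add_mul_mod_self_right, Nat.mod_eq_of_lt hi, 𝓕.add_mul_div,
    Nat.div_eq_of_lt hi, zero_add]
  split_ifs with hf
  · rfl
  · exact sum_const_zero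

open Classical in
theorem rest_mul_eq (n : ℕ) : 𝓕.rest (n * 𝓕.s) =
    ∑ i ∈ range 𝓕.s, if 𝓕.IsFree i then 0 else ∑ j ∈ range n, 𝓕.hilb (i + j * 𝓕.s) := by
  rw [rest, sum_range_mul_eq]
  refine sum_congr rfl fun i hi => ?_
  simp only [Nat.add_mul_mod_self_right, Nat.mod_eq_of_lt (mem_range.1 hi)]
  split_ifs with hf
  · exact sum_const_zero
  · rfl

theorem exists_rest_le : ∃ K : ℕ, ∀ n : ℕ, 𝓕.rest ((n + 1) * 𝓕.s) ≤ K * (n + D).choose D := by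
  classical
  have h : ∀ i, ∃ a : ℕ, i < 𝓕.s → ∀ n : ℕ,
      (if 𝓕.IsFree i then 0 else ∑ j ∈ range (n + 1), 𝓕.hilb (i + j * 𝓕.s)) ≤
        a * (n + D).choose D := by
    intro i
    by_cases hf : 𝓕.IsFree i
    · exact ⟨0, fun _ n => by simp [hf]⟩
    · by_cases hi : i < 𝓕.s
      · obtain ⟨a, ha⟩ := 𝓕.sum_hilb_le_of_not_isFree hi hf
        exact ⟨a, fun _ n => by simpa [hf] using ha n⟩
      · exact ⟨0, fun hi' => absurd hi' hi⟩
  choose a ha using h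
  refine ⟨∑ i ∈ range 𝓕.s, a i, fun n => ?_⟩
  rw [rest_mul_eq, sum_mul]
  exact sum_le_sum fun i hi => ha i (mem_range.1 hi) n

theorem le_rest_of_not_isSmall {i : ℕ} (hi : i < 𝓕.s) (hf : ¬ 𝓕.IsFree i) (h : ¬ 𝓕.IsSmall i)
    (n : ℕ) : (n + D).choose D ≤ 𝓕.rest ((n + 1) * 𝓕.s) := by
  classical
  rw [rest_mul_eq]
  refine le_trans ?_ (single_le_sum (fun i _ => Nat.zero_le _) (mem_range.2 hi))
  rw [if_neg hf]
  exact 𝓕.le_sum_hilb_of_not_isSmall hi h n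

theorem length_colon_le_rest {y : R} (hy : ∀ t, y ∈ 𝓕.sat t) (t : ℕ) :
    Module.length R (R ⧸ Submodule.comap (LinearMap.lsmul R R y) (𝓕.W t)) ≤ 𝓕.rest t := by
  induction t with
  | zero =>
    refine le_of_eq_of_le (Module.length_eq_zero_iff.2 ?_) zero_le
    rw [𝓕.W_zero]
    exact Ideal.Quotient.subsingleton_iff.2 rfl
  | succ t ih =>
    rw [rest, sum_range_succ, ← rest]
    split_ifs with hf
    · rw [add_zero]
      refine (length_quotient_anti fun r hr => ?_).trans ih
      exact 𝓕.mem_W_succ_of_mem_sat hf (Ideal.mul_mem_right _ _ (hy (t + 1))) hr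
    · have h1 := length_colon y (𝓕.W t)
      have h2 := length_colon y (𝓕.W (t + 1))
      have h3 := length_quotient_anti (sup_le_sup_right (𝓕.W_succ_le t) (y • (⊤ : Ideal R)))
      rw [length_quotient_W] at h1 h2
      rw [sum_range_succ, Nat.cast_add, h1] at h2
      have hne : Module.length R (R ⧸ 𝓕.W (t + 1) ⊔ y • (⊤ : Ideal R)) ≠ ⊤ := by
        intro htop
        rw [htop, add_top, ← h1, ← Nat.cast_add] at h2
        exact ENat.natCast_ne_top _ h2
      rw [Nat.cast_add]
      rw [← ENat.add_le_add_iff_right hne, ← h2]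
      rw [add_right_comm]
      exact add_le_add (add_le_add ih le_rfl) h3 |>.trans (by rw [add_right_comm])

end SocleFiltration

theorem exists_comap_lsmul_pow_le {R : Type*} [CommRing R] [IsNoetherianRing R] (Q : Ideal R)
    (y : R) : ∃ c : ℕ, ∀ n : ℕ, Submodule.comap (LinearMap.lsmul R R y) (Q ^ (n + c)) ≤
      (⊥ : Ideal R).colon {y} ⊔ Q ^ n := by
  obtain ⟨c, hc⟩ := Ideal.exists_pow_inf_eq_pow_smul Q (LinearMap.range (LinearMap.lsmul R R y))
  refine ⟨c, fun n z hz => ?_⟩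
  have h1 : y * z ∈ (Q ^ (n + c) • ⊤ : Ideal R) ⊓ LinearMap.range (LinearMap.lsmul R R y) := by
    refine ⟨?_, z, rfl⟩
    rw [smul_eq_mul, Ideal.mul_top]
    exact hz
  rw [hc _ (Nat.le_add_left c n), Nat.add_sub_cancel] at h1
  have h2 := Submodule.smul_mono (le_refl (Q ^ n)) (inf_le_right (a := (Q ^ c • ⊤ : Ideal R))) h1
  rw [LinearMap.range_eq_map, ← Submodule.map_smul'', smul_eq_mul, Ideal.mul_top] at h2
  obtain ⟨w, hw, hwz⟩ := h2
  rw [← sub_add_cancel z w]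
  refine Submodule.add_mem_sup (Submodule.mem_colon_singleton.2 ?_) hw
  have : y * w = y * z := hwz
  rw [Submodule.mem_bot, smul_eq_mul, mul_comm, mul_sub, this, sub_self]

namespace SocleFiltration

variable {R : Type*} [CommRing R] [IsLocalRing R] {D : ℕ}
  {x : Fin (D + 1) → R} (𝓕 : SocleFiltration (Ideal.span (Set.range x)))

theorem exists_ne_zero_mem_sat [IsAdicComplete (maximalIdeal R) R]
    (hQ : Ideal.span (Set.range x) ≤ maximalIdeal R)
    (h : ∀ i < 𝓕.s, ¬ 𝓕.IsFree i → 𝓕.IsSmall i) {i : ℕ} (hi : i < 𝓕.s) (hf : ¬ 𝓕.IsFree i) :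
    ∃ y, y ≠ 0 ∧ ∀ t, y ∈ 𝓕.sat t := by
  have h0 : 𝓕.a i ∈ 𝓕.sat (i + 1 + 0) := by
    refine 𝓕.sat_le_of_isSmall (t := i) ?_ (𝓕.W_le_sat i ?_)
    · rw [Nat.mod_eq_of_lt hi]
      exact h i hi hf
    · rw [𝓕.W_eq i hi]
      exact Ideal.mem_sup_right (Ideal.mem_span_singleton_self _)
  choose! w hwW hw using fun (t : ℕ) (z : R) (hz : z ∈ 𝓕.sat t) => 𝓕.exists_sub_mem_sat h t hz
  let z : ℕ → R := fun n => Nat.rec (𝓕.a i) (fun m v => v - w (i + 1 + m) v) n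
  have hz : ∀ n, z n ∈ 𝓕.sat (i + 1 + n) := by
    intro n
    induction n with
    | zero => exact h0
    | succ n ih => exact hw _ _ ih
  obtain ⟨L, hL⟩ := 𝓕.exists_sub_mem_W hQ (i + 1) z (fun n => by
    have : z (n + 1) - z n = - w (i + 1 + n) (z n) := by
      change z n - w (i + 1 + n) (z n) - z n = _
      ring
    rw [this]
    exact neg_mem (hwW _ _ (hz n)))
  refine ⟨L, ?_, fun t => ?_⟩
  · rintro rfl
    refine 𝓕.notMem i hi ?_
    have : 0 - 𝓕.a i ∈ 𝓕.W (i + 1) := hL 0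
    simpa using this
  · refine 𝓕.sat_antitone (Nat.le_add_left t (i + 1)) ?_
    have := add_mem (𝓕.W_le_sat _ (hL t)) (hz t)
    rwa [sub_add_cancel] at this

theorem isFree_of_forall_isSmall [IsNoetherianRing R] [IsAdicComplete (maximalIdeal R) R]
    (hQ : Ideal.span (Set.range x) ≤ maximalIdeal R)
    (hass : ∀ p ∈ associatedPrimes R R, ((D + 1 : ℕ) : WithBot ℕ∞) ≤ ringKrullDim (R ⧸ p))
    (h : ∀ i < 𝓕.s, ¬ 𝓕.IsFree i → 𝓕.IsSmall i) : ∀ i < 𝓕.s, 𝓕.IsFree i := by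
  intro i hi
  by_contra hf
  obtain ⟨y₀, hy₀, hy₀s⟩ := 𝓕.exists_ne_zero_mem_sat hQ h hi hf
  let N : Ideal R := ⨅ t, 𝓕.sat t
  obtain ⟨p, hp, -⟩ := exists_le_isAssociatedPrime_of_isNoetherianRing R
    (⟨y₀, by simpa [N] using hy₀s⟩ : N) (fun h0 => hy₀ (congrArg Subtype.val h0))
  obtain ⟨hprime, ⟨y, hyN⟩, hpy⟩ := isAssociatedPrime_iff.1 hp
  have hys : ∀ t, y ∈ 𝓕.sat t := by simpa [N] using hyN
  have hpy' : p = (⊥ : Ideal R).colon {y} := by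
    rw [hpy]
    ext r
    rw [Submodule.mem_colon_singleton, Submodule.mem_colon_singleton, Submodule.mem_bot,
      Submodule.mem_bot]
    exact Subtype.ext_iff
  obtain ⟨c, hc⟩ := exists_comap_lsmul_pow_le (Ideal.span (Set.range x)) y
  obtain ⟨K, hK⟩ := 𝓕.exists_rest_le
  have hdim := ringKrullDim_quotient_le_of_length_le _ hQ D p (K * (1 + c + D) ^ D) (by
    intro n hn
    refine (length_quotient_anti (hpy' ▸ hc n)).trans ?_
    have h1 := 𝓕.length_colon_le_rest hys ((n + c) * 𝓕.s)
    rw [𝓕.W_mul] at h1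
    refine h1.trans ?_
    obtain ⟨m, rfl⟩ := Nat.exists_eq_add_of_le' hn
    have h2 := hK (m + c)
    rw [show m + c + 1 = m + 1 + c by ring] at h2
    refine Nat.cast_le.2 (h2.trans ?_)
    rw [mul_assoc, ← mul_pow]
    refine Nat.mul_le_mul_left K ((Nat.choose_le_pow _ _).trans (Nat.pow_le_pow_left ?_ D))
    nlinarith [Nat.zero_le (c * m), Nat.zero_le (D * m)])
  have h1 := (hass p (isAssociatedPrime_iff.2 ⟨hprime, y, hpy'⟩)).trans hdim
  have h2 : D + 1 ≤ D := by exact_mod_cast h1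
  omega

theorem forall_isSmall (e : ℕ → ℤ) (he1 : 0 ≤ e 1)
    (he : ∀ᶠ n in Filter.atTop, Module.length R (R ⧸ Ideal.span (Set.range x) ^ (n + 1)) ≠ ⊤ ∧
      ((Module.length R (R ⧸ Ideal.span (Set.range x) ^ (n + 1))).toNat : ℤ) =
      ∑ i ∈ range (D + 1 + 1), (-1 : ℤ) ^ i * e i * ((n + (D + 1) - i).choose (D + 1 - i))) :
    ∀ i < 𝓕.s, ¬ 𝓕.IsFree i → 𝓕.IsSmall i := by
  intro i hi hf
  by_contra hs
  obtain ⟨K, hK⟩ := 𝓕.exists_rest_le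
  have hlim := tendsto_div_choose_of_hilbert D e 𝓕.freeRank (fun n => 𝓕.rest ((n + 1) * 𝓕.s)) K hK
    (he.mono fun n hn => by
      rw [← hn.2, ← 𝓕.W_mul, 𝓕.length_quotient_W, 𝓕.sum_hilb_eq]
      rfl)
  have h1 : (1 : ℝ) ≤ -(e 1 : ℝ) := by
    refine ge_of_tendsto' hlim fun n => ?_
    rw [one_le_div (by exact_mod_cast Nat.choose_pos (Nat.le_add_left D n))]
    exact_mod_cast 𝓕.le_rest_of_not_isSmall hi hf hs n
  have h2 : (0 : ℝ) ≤ (e 1 : ℝ) := by exact_mod_cast he1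
  linarith

end SocleFiltration

/-- The Hilbert function of a parameter ideal with nonnegative first coefficient in a complete
unmixed ring. -/
theorem length_quotient_pow_eq_of_isAdicComplete {R : Type*} [CommRing R] [IsNoetherianRing R]
    [IsLocalRing R] [IsAdicComplete (maximalIdeal R) R] {D : ℕ} (x : Fin (D + 1) → R)
    (hQ : Ideal.span (Set.range x) ≤ maximalIdeal R) (N : ℕ)
    (hN : maximalIdeal R ^ N ≤ Ideal.span (Set.range x))
    (hass : ∀ p ∈ associatedPrimes R R, ((D + 1 : ℕ) : WithBot ℕ∞) ≤ ringKrullDim (R ⧸ p))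
    (e : ℕ → ℤ) (he1 : 0 ≤ e 1)
    (he : ∀ᶠ n in Filter.atTop, Module.length R (R ⧸ Ideal.span (Set.range x) ^ (n + 1)) ≠ ⊤ ∧
      ((Module.length R (R ⧸ Ideal.span (Set.range x) ^ (n + 1))).toNat : ℤ) =
      ∑ i ∈ range (D + 1 + 1), (-1 : ℤ) ^ i * e i * ((n + (D + 1) - i).choose (D + 1 - i)))
    (n : ℕ) :
    Module.length R (R ⧸ Ideal.span (Set.range x) ^ (n + 1)) =
      Module.length R (R ⧸ Ideal.span (Set.range x)) * ((n + (D + 1)).choose (D + 1) : ℕ) := by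
  obtain ⟨𝓕⟩ := nonempty_socleFiltration _ hQ N hN
  have hfree := 𝓕.isFree_of_forall_isSmall hQ hass (𝓕.forall_isSmall e he1 he)
  have h : ∀ n, Module.length R (R ⧸ Ideal.span (Set.range x) ^ (n + 1)) =
      ((𝓕.freeRank * (n + (D + 1)).choose (D + 1) : ℕ) : ℕ∞) := by
    intro n
    have : 𝓕.rest ((n + 1) * 𝓕.s) = 0 :=
      sum_eq_zero fun j _ => if_pos (hfree _ (Nat.mod_lt j 𝓕.s_pos))
    rw [← 𝓕.W_mul, 𝓕.length_quotient_W, 𝓕.sum_hilb_eq, this, add_zero]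
  have h0 := h 0
  rw [zero_add, pow_one, zero_add, Nat.choose_self, mul_one] at h0
  rw [h n, h0, Nat.cast_mul]

section

variable {A S : Type*} [CommRing A] [CommRing S] [Algebra A S] (I : Ideal S) {σ : Type*}
  (x : σ → S) (hx : ∀ i, x i ∈ I)

include hx in
theorem idealOfVars_pow_le_comap (n : ℕ) : MvPolynomial.idealOfVars σ A ^ n ≤
    (I ^ n).comap (MvPolynomial.aeval (R := A) x).toRingHom := by
  refine le_trans (Ideal.pow_right_mono ?_ n) (Ideal.le_comap_pow _ n)
  rw [MvPolynomial.idealOfVars, Ideal.span_le]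
  rintro _ ⟨i, rfl⟩
  simpa using hx i

variable [Finite σ]

/-- Evaluation of a power series at elements of `I`, modulo `I ^ n`. -/
noncomputable def evalModPow (n : ℕ) : MvPowerSeries σ A →+* S ⧸ I ^ n :=
  (Ideal.quotientMap (I ^ n) (MvPolynomial.aeval (R := A) x).toRingHom
    (idealOfVars_pow_le_comap I x hx n)).comp (MvPowerSeries.truncTotalAlgHom σ A n).toRingHom

theorem evalModPow_apply (n : ℕ) (p : MvPowerSeries σ A) :
    evalModPow I x hx n p = Ideal.Quotient.mk _ (MvPolynomial.aeval x (p.truncTotal n)) := rfl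

theorem evalModPow_coe (n : ℕ) (p : MvPolynomial σ A) :
    evalModPow I x hx n (p : MvPowerSeries σ A) = Ideal.Quotient.mk _ (MvPolynomial.aeval x p) := by
  have h := (MvPowerSeries.truncTotalAlgHom σ A n).commutes p
  have h2 : MvPowerSeries.truncTotalAlgHom σ A n (p : MvPowerSeries σ A) =
    Ideal.Quotient.mk _ p := h
  change Ideal.quotientMap _ _ (idealOfVars_pow_le_comap I x hx n)
    (MvPowerSeries.truncTotalAlgHom σ A n (p : MvPowerSeries σ A)) = _
  rw [h2]
  rfl

theorem factorPow_comp_evalModPow {m n : ℕ} (hle : m ≤ n) :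
    (Ideal.Quotient.factorPow I hle).comp (evalModPow (A := A) I x hx n) =
      evalModPow I x hx m := by
  ext p
  rw [RingHom.comp_apply, evalModPow_apply, evalModPow_apply]
  change Ideal.Quotient.mk _ _ = _
  rw [Ideal.Quotient.mk_eq_mk_iff_sub_mem, ← map_sub]
  exact idealOfVars_pow_le_comap I x hx m
    (MvPowerSeries.truncTotal_sub_truncTotal_mem_pow_idealOfVars hle le_rfl p)

/-- A ring complete with respect to a finitely generated ideal `I` is Noetherian if it is an algebra
over a Noetherian ring surjecting onto `S ⧸ I`. -/
theorem isNoetherianRing_of_isAdicComplete [IsNoetherianRing A] [IsAdicComplete I S] (hI : I.FG)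
    (h : Function.Surjective ((Ideal.Quotient.mk I).comp (algebraMap A S))) :
    IsNoetherianRing S := by
  obtain ⟨r, x, rfl⟩ := Submodule.fg_iff_exists_fin_generating_family.1 hI
  set I : Ideal S := Submodule.span S (Set.range x) with hIdef
  have hx : ∀ i, x i ∈ I := fun i => Submodule.subset_span ⟨i, rfl⟩
  let F : MvPowerSeries (Fin r) A →+* S := IsAdicComplete.liftRingHom I (evalModPow I x hx)
    (factorPow_comp_evalModPow I x hx)
  have hF : ∀ p : MvPolynomial (Fin r) A,
      F (p : MvPowerSeries (Fin r) A) = MvPolynomial.aeval x p := by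
    intro p
    refine (IsHausdorff.eq_iff_smodEq (I := I)).2 fun n => ?_
    rw [SModEq.sub_mem, smul_eq_mul, Ideal.mul_top, ← Ideal.Quotient.mk_eq_mk_iff_sub_mem]
    rw [IsAdicComplete.mk_liftRingHom, evalModPow_coe]
  have hmap : (Ideal.span (Set.range MvPowerSeries.X)).map F = I := by
    rw [Ideal.map_span, ← Set.range_comp, hIdef, Ideal.submodule_span_eq]
    congr 2
    funext i
    simpa using hF (MvPolynomial.X i)
  refine isNoetherianRing_of_surjective _ _ F ?_
  have : IsHausdorff ((Ideal.span (Set.range MvPowerSeries.X)).map F) S := by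
    rw [hmap]; infer_instance
  refine surjective_of_mk_map_comp_surjective F (I := Ideal.span (Set.range MvPowerSeries.X)) ?_
  rw [hmap]
  intro y
  obtain ⟨a, rfl⟩ := h y
  refine ⟨((MvPolynomial.C a : MvPolynomial (Fin r) A) : MvPowerSeries (Fin r) A), ?_⟩
  simp only [RingHom.comp_apply]
  rw [hF, MvPolynomial.aeval_C]

end

section Completion

variable (R : Type*) [CommRing R] [IsNoetherianRing R] [IsLocalRing R]

theorem AdicCompletion.isNoetherianRing_maximalIdeal :
    IsNoetherianRing (AdicCompletion (maximalIdeal R) R) := by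
  refine isNoetherianRing_of_isAdicComplete (A := R)
    (maximalIdeal (AdicCompletion (maximalIdeal R) R)) ?_ ?_
  · rw [AdicCompletion.maximalIdeal_eq_map]
    exact (maximalIdeal R).fg_of_isNoetherianRing.map _
  · have := (AdicCompletion.residueField_map_bijective (R := R)).2
    intro y
    obtain ⟨z, hz⟩ := this y
    obtain ⟨a, rfl⟩ := IsLocalRing.residue_surjective z
    exact ⟨a, hz⟩

theorem AdicCompletion.ringKrullDim_le_ringKrullDim :
    ringKrullDim R ≤ ringKrullDim (AdicCompletion (maximalIdeal R) R) := by
  have := AdicCompletion.isNoetherianRing_maximalIdeal R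
  have : (maximalIdeal (AdicCompletion (maximalIdeal R) R)).LiesOver (maximalIdeal R) :=
    ⟨(IsLocalRing.maximalIdeal_comap (algebraMap R (AdicCompletion (maximalIdeal R) R))).symm⟩
  rw [← maximalIdeal_height_eq_ringKrullDim, ← maximalIdeal_height_eq_ringKrullDim,
    Ideal.height_eq_height_add_of_liesOver_of_hasGoingDown (maximalIdeal R)
      (maximalIdeal (AdicCompletion (maximalIdeal R) R))]
  exact WithBot.coe_le_coe.2 le_self_add

variable {R}

theorem AdicCompletion.length_quotient_map (I : Ideal R) (N : ℕ) (hN : maximalIdeal R ^ N ≤ I) :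
    Module.length (AdicCompletion (maximalIdeal R) R) (AdicCompletion (maximalIdeal R) R ⧸
      I.map (algebraMap R (AdicCompletion (maximalIdeal R) R))) = Module.length R (R ⧸ I) := by
  set S := AdicCompletion (maximalIdeal R) R with hS
  set J := I.map (algebraMap R S) with hJ
  have hker : ∀ y : S, AdicCompletion.evalₐ (maximalIdeal R) N y = 0 → y ∈ J := by
    intro y hy
    have h1 : y ∈ (maximalIdeal R ^ N • ⊤ : Submodule R S) := by
      rw [AdicCompletion.pow_smul_top_eq_ker_eval (maximalIdeal R).fg_of_isNoetherianRing,
        LinearMap.mem_ker]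
      have h2 : maximalIdeal R ^ N ≤ maximalIdeal R ^ N • (⊤ : Ideal R) := by
        rw [smul_eq_mul, Ideal.mul_top]
      exact (AdicCompletion.factor_evalₐ_eq_eval (maximalIdeal R) y h2).symm.trans
        ((congrArg (Ideal.Quotient.factor h2) hy).trans (_root_.map_zero _))
    rw [Ideal.smul_top_eq_map] at h1
    exact Ideal.map_mono hN h1
  have hsurj : Function.Surjective (algebraMap R (S ⧸ J)) := by
    intro z
    obtain ⟨y, rfl⟩ := Ideal.Quotient.mk_surjective z
    obtain ⟨a, ha⟩ := Ideal.Quotient.mk_surjective (AdicCompletion.evalₐ (maximalIdeal R) N y)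
    refine ⟨a, (Ideal.Quotient.mk_eq_mk_iff_sub_mem _ _).2 (hker _ ?_)⟩
    rw [map_sub, ← ha, AdicCompletion.algebraMap_apply, AdicCompletion.evalₐ_of]
    exact sub_self _
  have hk : LinearMap.ker (Algebra.linearMap R (S ⧸ J)) = I := by
    ext a
    rw [LinearMap.mem_ker, Algebra.linearMap_apply]
    refine Iff.trans (Ideal.Quotient.eq_zero_iff_mem (I := J) (a := algebraMap R S a))
      ⟨?_, fun h => Ideal.mem_map_of_mem _ h⟩
    intro h
    have h1 : J ≤ (I.map (Ideal.Quotient.mk (maximalIdeal R ^ N))).comap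
        (AdicCompletion.evalₐ (maximalIdeal R) N).toRingHom := by
      refine Ideal.map_le_iff_le_comap.2 fun b hb => ?_
      have := Ideal.mem_map_of_mem (Ideal.Quotient.mk (maximalIdeal R ^ N)) hb
      simpa [AdicCompletion.algebraMap_apply] using this
    have h2 : Ideal.Quotient.mk (maximalIdeal R ^ N) a ∈
        I.map (Ideal.Quotient.mk (maximalIdeal R ^ N)) := by
      simpa [AdicCompletion.algebraMap_apply] using h1 h
    exact (Ideal.mem_quotient_iff_mem hN).1 h2
  have h1 := Module.length_eq_of_surjective (R := S ⧸ J) (S := S) (M := S ⧸ J)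
    (Ideal.Quotient.mk_surjective (I := J))
  have h2 := Module.length_eq_of_surjective (M := S ⧸ J) hsurj
  rw [h1, ← h2]
  have e := (Algebra.linearMap R (S ⧸ J)).quotKerEquivOfSurjective hsurj
  rw [hk] at e
  exact e.length_eq.symm

end Completion

theorem Ideal.ofList_ofFn {R : Type*} [CommRing R] {d : ℕ} (x : Fin d → R) :
    Ideal.ofList (List.ofFn x) = Ideal.span (Set.range x) := by
  rw [Ideal.ofList]
  congr 1
  ext a
  simp [List.mem_ofFn]

theorem moduleLength_eq_natCast_iff {R M : Type*} [CommRing R] [AddCommGroup M] [Module R M]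
    {l : ℕ} : moduleLength R M = (l : WithBot ℕ∞) ↔ Module.length R M = l := by
  rw [moduleLength, ← Module.coe_length]
  exact WithBot.coe_inj (a := Module.length R M) (b := (l : ℕ∞))

section

variable {R : Type*} [CommRing R] [IsLocalRing R]

theorem exists_pow_le_of_length_quotient_ne_top (Q : Ideal R)
    (hQ : Module.length R (R ⧸ Q) ≠ ⊤) : ∃ N, maximalIdeal R ^ N ≤ Q := by
  have hfin : IsFiniteLength R (R ⧸ Q) := Module.length_ne_top_iff.1 hQ
  have : IsArtinian R (R ⧸ Q) := (isFiniteLength_iff_isNoetherian_isArtinian.1 hfin).2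
  have : IsArtinianRing (R ⧸ Q) := isArtinian_of_tower R this
  exact exists_maximalIdeal_pow_le_of_isArtinianRing_quotient Q

variable [IsNoetherianRing R]

theorem isUnmixedLocalRing_of_isCohenMacaulayLocalRing {d : ℕ} (x : Fin d → R)
    (hx : Ideal.span (Set.range x) ≤ maximalIdeal R) (N : ℕ)
    (hN : maximalIdeal R ^ N ≤ Ideal.span (Set.range x)) (hdim : ringKrullDim R = d)
    (h : IsCohenMacaulayLocalRing R) : IsUnmixedLocalRing R := by
  obtain ⟨rs, hrm, hr, hlen⟩ := h
  intro p hp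
  have := AdicCompletion.isNoetherianRing_maximalIdeal R
  set S := AdicCompletion (maximalIdeal R) R
  have hmS : maximalIdeal S = (maximalIdeal R).map (algebraMap R S) :=
    AdicCompletion.maximalIdeal_eq_map
  have hmem : ∀ a ∈ maximalIdeal R, algebraMap R S a ∈ maximalIdeal S := fun a ha =>
    hmS ▸ Ideal.mem_map_of_mem _ ha
  have h1 := length_le_ringKrullDim_quotient_of_mem_associatedPrimes (rs.map (algebraMap R S)) S
    (fun y hy => by
      obtain ⟨a, ha, rfl⟩ := List.mem_map.1 hy
      exact hmem a (hrm a ha)) hr.1.of_flat p hp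
  rw [List.length_map, hlen, hdim] at h1
  have h2 : ringKrullDim S ≤ d := by
    have h3 := ringKrullDim_quotient_le_length (⊥ : Ideal S) bot_le
      ((List.ofFn x).map (algebraMap R S)) (fun y hy => by
        obtain ⟨a, ha, rfl⟩ := List.mem_map.1 hy
        refine hmem a (hx (Ideal.subset_span ?_))
        simpa [List.mem_ofFn] using ha) N (by
        rw [bot_sup_eq, ← Ideal.map_ofList, Ideal.ofList_ofFn, hmS, ← Ideal.map_pow]
        exact Ideal.map_mono hN)
    rw [List.length_map, List.length_ofFn,
      ringKrullDim_eq_of_ringEquiv (RingEquiv.quotientBot S)] at h3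
    exact h3
  exact le_antisymm (ringKrullDim_quotient_le p) (h2.trans h1)

theorem coeff_one_eq_zero_of_isCohenMacaulayLocalRing {D : ℕ} (x : Fin (D + 1) → R)
    (hx : Ideal.span (Set.range x) ≤ maximalIdeal R)
    (hℓ : Module.length R (R ⧸ Ideal.span (Set.range x)) ≠ ⊤)
    (hdim : ringKrullDim R = (D + 1 : ℕ)) (e : ℕ → ℤ)
    (he : ∀ᶠ n in Filter.atTop, Module.length R (R ⧸ Ideal.span (Set.range x) ^ (n + 1)) ≠ ⊤ ∧
      ((Module.length R (R ⧸ Ideal.span (Set.range x) ^ (n + 1))).toNat : ℤ) =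
      ∑ i ∈ range (D + 1 + 1), (-1 : ℤ) ^ i * e i * ((n + (D + 1) - i).choose (D + 1 - i)))
    (h : IsCohenMacaulayLocalRing R) : e 1 = 0 := by
  obtain ⟨rs, hrm, hr, hlen⟩ := h
  obtain ⟨N, hN⟩ := exists_pow_le_of_length_quotient_ne_top _ hℓ
  have hxm : ∀ a ∈ List.ofFn x, a ∈ maximalIdeal R := fun a ha =>
    hx (Ideal.subset_span (List.mem_ofFn.1 ha))
  have hreg := isWeaklyRegular_of_pow_le (List.ofFn x) R rs
    (by rw [List.length_ofFn]; rw [hdim] at hlen; exact_mod_cast hlen) hrm hr hxm N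
    (by rw [Ideal.ofList_ofFn]; exact hN.trans le_sup_right)
  have hlim := tendsto_div_choose_of_hilbert D e
    (Module.length R (R ⧸ Ideal.span (Set.range x))).toNat (fun _ => 0) 0 (by simp)
    (he.mono fun n hn => by
      have h1 := length_quotient_pow_eq (List.ofFn x) R hxm hreg n
      rw [Ideal.ofList_ofFn, smul_eq_mul, Ideal.mul_top, smul_eq_mul, Ideal.mul_top,
        List.length_ofFn] at h1
      rw [← hn.2, h1, ENat.toNat_mul, add_zero]
      rfl)
  have h0 : -(e 1 : ℝ) = 0 := tendsto_nhds_unique hlim (by simp)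
  exact_mod_cast neg_eq_zero.1 h0

theorem isCohenMacaulayLocalRing_of_isUnmixedLocalRing {D : ℕ} (x : Fin (D + 1) → R)
    (hx : Ideal.span (Set.range x) ≤ maximalIdeal R)
    (hℓ : Module.length R (R ⧸ Ideal.span (Set.range x)) ≠ ⊤)
    (hdim : ringKrullDim R = (D + 1 : ℕ)) (e : ℕ → ℤ)
    (he : ∀ᶠ n in Filter.atTop, Module.length R (R ⧸ Ideal.span (Set.range x) ^ (n + 1)) ≠ ⊤ ∧
      ((Module.length R (R ⧸ Ideal.span (Set.range x) ^ (n + 1))).toNat : ℤ) =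
      ∑ i ∈ range (D + 1 + 1), (-1 : ℤ) ^ i * e i * ((n + (D + 1) - i).choose (D + 1 - i)))
    (hu : IsUnmixedLocalRing R) (he1 : 0 ≤ e 1) : IsCohenMacaulayLocalRing R := by
  have := AdicCompletion.isNoetherianRing_maximalIdeal R
  have hdS := AdicCompletion.ringKrullDim_le_ringKrullDim R
  obtain ⟨N, hN⟩ := exists_pow_le_of_length_quotient_ne_top _ hℓ
  set S := AdicCompletion (maximalIdeal R) R with hS
  have hmS : maximalIdeal S = (maximalIdeal R).map (algebraMap R S) :=
    AdicCompletion.maximalIdeal_eq_map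
  have hmap : Ideal.span (Set.range (algebraMap R S ∘ x)) =
      (Ideal.span (Set.range x)).map (algebraMap R S) := by
    rw [Ideal.map_span, ← Set.range_comp]
  have hlen : ∀ n, Module.length S (S ⧸ Ideal.span (Set.range (algebraMap R S ∘ x)) ^ n) =
      Module.length R (R ⧸ Ideal.span (Set.range x) ^ n) := fun n => by
    rw [hmap, ← Ideal.map_pow]
    exact AdicCompletion.length_quotient_map _ (N * n)
      (by rw [pow_mul]; exact Ideal.pow_right_mono hN n)
  have hF := length_quotient_pow_eq_of_isAdicComplete (algebraMap R S ∘ x)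
    (by rw [hmap, hmS]; exact Ideal.map_mono hx) N
    (by rw [hmap, hmS, ← Ideal.map_pow]; exact Ideal.map_mono hN)
    (fun p hp => by rw [hu p hp, ← hdim]; exact hdS) e he1
    (he.mono fun n hn => by rw [hlen]; exact hn)
  have hlen1 := hlen 1
  rw [pow_one, pow_one] at hlen1
  have hxm : ∀ a ∈ List.ofFn x, a ∈ maximalIdeal R := fun a ha =>
    hx (Ideal.subset_span (List.mem_ofFn.1 ha))
  have hreg := isWeaklyRegular_of_length (List.ofFn x) R hxm
    (by rwa [Ideal.ofList_ofFn, smul_eq_mul, Ideal.mul_top]) (fun n => by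
      rw [Ideal.ofList_ofFn, smul_eq_mul, Ideal.mul_top, smul_eq_mul, Ideal.mul_top,
        List.length_ofFn, ← hlen, ← hlen1]
      exact (hF n).ge)
  exact ⟨List.ofFn x, hxm,
    RingTheory.Sequence.IsRegular.of_isWeaklyRegular_of_mem_maximalIdeal R hxm hreg,
    by rw [List.length_ofFn, hdim]⟩

end

/-- **Ghezzi–Goto–Hong–Ozeki–Phuong–Vasconcelos, Theorem 2.1** (Vasconcelos' Vanishing
Conjecture).  Let `(R,m)` be a Noetherian local ring of dimension `d > 0` and `Q` a
parameter ideal.  TFAE: (i) `R` is Cohen-Macaulay; (ii) `R` is unmixed and `e₁(Q) = 0`;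
(iii) `R` is unmixed and `e₁(Q) ≥ 0`. -/
theorem vanishing_conjecture
    {R : Type*} [CommRing R] [IsNoetherianRing R] [IsLocalRing R]
    (d : ℕ) (hd : 0 < d) (hdim : ringKrullDim R = d)
    (Q : Ideal R) (hQ : IsParameterIdeal d Q)
    (e : ℕ → ℤ) (he : HasHilbertCoeffs Q d e) :
    (IsCohenMacaulayLocalRing R ↔ (IsUnmixedLocalRing R ∧ e 1 = 0)) ∧
      ((IsUnmixedLocalRing R ∧ e 1 = 0) ↔ (IsUnmixedLocalRing R ∧ 0 ≤ e 1)) := by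
  obtain ⟨D, rfl⟩ := Nat.exists_eq_add_of_lt hd
  rw [zero_add] at *
  obtain ⟨hQm, ⟨x, rfl⟩, l, hl⟩ := hQ
  have hℓ : Module.length R (R ⧸ Ideal.span (Set.range x)) ≠ ⊤ := by
    rw [moduleLength_eq_natCast_iff.1 hl]
    exact ENat.natCast_ne_top l
  obtain ⟨N, hN⟩ := exists_pow_le_of_length_quotient_ne_top _ hℓ
  obtain ⟨n₀, he⟩ := he
  have he' := Filter.eventually_atTop.2 ⟨n₀, fun n hn => by
    obtain ⟨l', hl', hsum⟩ := he n hn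
    rw [moduleLength_eq_natCast_iff] at hl'
    have h : Module.length R (R ⧸ Ideal.span (Set.range x) ^ (n + 1)) ≠ ⊤ ∧
        ((Module.length R (R ⧸ Ideal.span (Set.range x) ^ (n + 1))).toNat : ℤ) =
        ∑ i ∈ range (D + 1 + 1), (-1 : ℤ) ^ i * e i *
          ((n + (D + 1) - i).choose (D + 1 - i)) := by
      rw [hl']
      exact ⟨ENat.natCast_ne_top l', hsum⟩
    exact h⟩
  have h12 : IsCohenMacaulayLocalRing R → IsUnmixedLocalRing R ∧ e 1 = 0 := fun h =>
    ⟨isUnmixedLocalRing_of_isCohenMacaulayLocalRing x hQm N hN hdim h,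
      coeff_one_eq_zero_of_isCohenMacaulayLocalRing x hQm hℓ hdim e he' h⟩
  have h31 : IsUnmixedLocalRing R ∧ 0 ≤ e 1 → IsCohenMacaulayLocalRing R := fun h =>
    isCohenMacaulayLocalRing_of_isUnmixedLocalRing x hQm hℓ hdim e he' h.1 h.2
  exact ⟨⟨h12, fun h => h31 ⟨h.1, h.2.ge⟩⟩, fun h => ⟨h.1, h.2.ge⟩, fun h => h12 (h31 h)⟩
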